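/- Let n ≥ 2. Every bounded weak carrot domain Ω ⊆ ℝⁿ supports, for every s ∈ (0,1], an s-Hajłasz–Trudinger imbedding: there is a constant C > 0 such that ‖u − u_Ω‖_{φ_s(L)(Ω)} ≤ C ‖u‖_{Ṁ^{s,n/s}_ball(Ω)} for all u ∈ Ṁ^{s,n/s}_ball(Ω). -/

import Mathlib

open MeasureTheory Metric Set
open scoped ENNReal

noncomputable section

/-- Euclidean space `ℝⁿ`. -/
abbrev Eu (n : ℕ) : Type := EuclideanSpace ℝ (Fin n)

/-- A domain: a nonempty open connected subset. -/
def IsDomainEu {n : ℕ} (Ω : Set (Eu n)) : Prop := IsOpen Ω ∧ IsConnected Ω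

/-- The Hajłasz gradient class `𝒟^{s,ρ}_ball(u)` on `Ω`: nonnegative measurable `g` such that
`|u x - u y| ≤ |x-y|^s (g x + g y)` for all `x, y ∈ Ω` off a null set with
`|x - y| < ρ · dist(x, ∂Ω)`. -/
def DBall {n : ℕ} (Ω : Set (Eu n)) (s ρ : ℝ) (u : Eu n → ℝ) : Set (Eu n → ℝ) :=
  {g | Measurable g ∧ (∀ x, 0 ≤ g x) ∧
    ∃ N : Set (Eu n), N ⊆ Ω ∧ volume N = 0 ∧
      ∀ x ∈ Ω \ N, ∀ y ∈ Ω \ N,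
        edist x y < ENNReal.ofReal ρ * EMetric.infEdist x Ωᶜ →
        |u x - u y| ≤ dist x y ^ s * (g x + g y)}

/-- The full Hajłasz gradient class `𝒟^s(u)` on `U`. -/
def DFull {n : ℕ} (U : Set (Eu n)) (s : ℝ) (u : Eu n → ℝ) : Set (Eu n → ℝ) :=
  {g | Measurable g ∧ (∀ x, 0 ≤ g x) ∧
    ∃ N : Set (Eu n), N ⊆ U ∧ volume N = 0 ∧
      ∀ x ∈ U \ N, ∀ y ∈ U \ N, |u x - u y| ≤ dist x y ^ s * (g x + g y)}

/-- `inf_{g ∈ 𝒟^{s,ρ}_ball(u)} ‖g‖_{L^p(Ω)}`. -/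
def ballNormRho {n : ℕ} (Ω : Set (Eu n)) (s p ρ : ℝ) (u : Eu n → ℝ) : ℝ≥0∞ :=
  ⨅ g ∈ DBall Ω s ρ u, eLpNorm g (ENNReal.ofReal p) (volume.restrict Ω)

/-- The `Ṁ^{s,p}_ball(Ω)` seminorm (with `ρ = 1/2`). -/
def ballNorm {n : ℕ} (Ω : Set (Eu n)) (s p : ℝ) (u : Eu n → ℝ) : ℝ≥0∞ :=
  ballNormRho Ω s p (1/2) u

/-- The `Ṁ^{s,p}(U)` seminorm. -/
def fullNorm {n : ℕ} (U : Set (Eu n)) (s p : ℝ) (u : Eu n → ℝ) : ℝ≥0∞ :=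
  ⨅ g ∈ DFull U s u, eLpNorm g (ENNReal.ofReal p) (volume.restrict U)

/-- Membership in `Ṁ^{s,p}_ball(Ω)`. -/
def MemMball {n : ℕ} (Ω : Set (Eu n)) (s p : ℝ) (u : Eu n → ℝ) : Prop :=
  Measurable u ∧ ballNorm Ω s p u < ⊤

/-- Membership in `Ṁ^{s,p}(U)`. -/
def MemMfull {n : ℕ} (U : Set (Eu n)) (s p : ℝ) (u : Eu n → ℝ) : Prop :=
  Measurable u ∧ fullNorm U s p u < ⊤

/-- `Ω` supports a `(pn/(n-ps), p)_s`-Hajłasz–Sobolev–Poincaré imbedding. -/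
def SupportsHSP {n : ℕ} (Ω : Set (Eu n)) (s p : ℝ) : Prop :=
  ∃ C : ℝ, 0 < C ∧ ∀ u : Eu n → ℝ, MemMball Ω s p u →
    eLpNorm (fun x => u x - ⨍ y in Ω, u y)
        (ENNReal.ofReal (p * n / (n - p * s))) (volume.restrict Ω)
      ≤ ENNReal.ofReal C * ballNorm Ω s p u

/-- LLC(2) with constant `b`: points of `Ω \ B(z,r)` lie in the same connected component
of `Ω \ B(z, br)`. -/
def LLC2With {n : ℕ} (Ω : Set (Eu n)) (b : ℝ) : Prop :=
  ∀ (z : Eu n) (r : ℝ), 0 < r →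
    ∀ x ∈ Ω \ ball z r, ∀ y ∈ Ω \ ball z r,
      y ∈ connectedComponentIn (Ω \ ball z (b * r)) x

/-- The LLC(2) property. -/
def LLC2 {n : ℕ} (Ω : Set (Eu n)) : Prop :=
  ∃ b : ℝ, b ∈ Set.Ioo (0:ℝ) 1 ∧ LLC2With Ω b

/-- `Ω` is an `Ṁ^{s,p}_ball`-extension domain. -/
def IsMballExtensionDomain {n : ℕ} (Ω : Set (Eu n)) (s p : ℝ) : Prop :=
  ∃ C : ℝ, 0 < C ∧ ∀ u : Eu n → ℝ, MemMball Ω s p u →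
    ∃ v : Eu n → ℝ, MemMball (Set.univ) s p v ∧ (∀ x ∈ Ω, v x = u x) ∧
      ballNorm (Set.univ) s p v ≤ ENNReal.ofReal C * ballNorm Ω s p u

/-- `Ω` is a John domain: there are `x₀ ∈ Ω` and `C > 0` such that every `x ∈ Ω` is joined to
`x₀` by a curve parametrized by arclength (here: `1`-Lipschitz) with
`dist(γ t, Ωᶜ) ≥ C t`. -/
def IsJohnDomain {n : ℕ} (Ω : Set (Eu n)) : Prop :=
  ∃ x₀ ∈ Ω, ∃ C : ℝ, 0 < C ∧ ∀ x ∈ Ω, ∃ ℓ : ℝ, 0 ≤ ℓ ∧ ∃ γ : ℝ → Eu n,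
    LipschitzOnWith 1 γ (Set.Icc 0 ℓ) ∧ γ 0 = x ∧ γ ℓ = x₀ ∧
    ∀ t ∈ Set.Icc (0:ℝ) ℓ, γ t ∈ Ω ∧ C * t ≤ infDist (γ t) Ωᶜ

/-- Quasihyperbolic distance: infimum over arclength-parametrized (`1`-Lipschitz) curves in `Ω`
joining `x` to `y` of `∫ dist(γ t, Ωᶜ)⁻¹ dt`. -/
def qhDist {n : ℕ} (Ω : Set (Eu n)) (x y : Eu n) : ℝ :=
  sInf { k : ℝ | ∃ ℓ : ℝ, 0 ≤ ℓ ∧ ∃ γ : ℝ → Eu n,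
    LipschitzOnWith 1 γ (Set.Icc 0 ℓ) ∧ γ 0 = x ∧ γ ℓ = y ∧
    (∀ t ∈ Set.Icc (0:ℝ) ℓ, γ t ∈ Ω) ∧
    k = ∫ t in (0:ℝ)..ℓ, (infDist (γ t) Ωᶜ)⁻¹ }

/-- Weak carrot domain (quasihyperbolic boundary condition). -/
def IsWeakCarrot {n : ℕ} (Ω : Set (Eu n)) : Prop :=
  ∃ x₀ ∈ Ω, ∃ C : ℝ, 1 ≤ C ∧ ∀ x ∈ Ω,
    qhDist Ω x x₀ ≤ C * Real.log (C / infDist x Ωᶜ)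

/-- The Luxemburg norm `‖u‖_{φ_s(L)(Ω)}` with `φ_s(t) = exp(t^{n/(n-s)}) - 1`
(value `⊤` when no admissible `t` exists). -/
def phiLux {n : ℕ} (Ω : Set (Eu n)) (s : ℝ) (u : Eu n → ℝ) : ℝ≥0∞ :=
  sInf (ENNReal.ofReal '' { t : ℝ | 0 < t ∧
    (∫⁻ x in Ω, ENNReal.ofReal
        (Real.exp ((|u x| / t) ^ ((n : ℝ) / ((n : ℝ) - s))) - 1)) ≤ 1 })

/-- `Ω` supports an `s`-Hajłasz–Trudinger imbedding. -/
def SupportsHT {n : ℕ} (Ω : Set (Eu n)) (s : ℝ) : Prop :=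
  ∃ C : ℝ, 0 < C ∧ ∀ u : Eu n → ℝ, MemMball Ω s ((n : ℝ) / s) u →
    phiLux Ω s (fun x => u x - ⨍ y in Ω, u y)
      ≤ ENNReal.ofReal C * ballNorm Ω s ((n : ℝ) / s) u

/-- The separation property with respect to `x₀` and `C`. -/
def SeparationProperty {n : ℕ} (Ω : Set (Eu n)) (x₀ : Eu n) (C : ℝ) : Prop :=
  ∀ x ∈ Ω, ∃ γ : ℝ → Eu n, ContinuousOn γ (Set.Icc 0 1) ∧
    (∀ t ∈ Set.Icc (0:ℝ) 1, γ t ∈ Ω) ∧ γ 0 = x ∧ γ 1 = x₀ ∧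
    ∀ t ∈ Set.Ioc (0:ℝ) 1,
      γ '' Set.Icc 0 t ⊆ ball (γ t) (C * infDist (γ t) Ωᶜ) ∨
      ∀ y ∈ γ '' Set.Icc 0 t \ ball (γ t) (C * infDist (γ t) Ωᶜ),
        connectedComponentIn (Ω \ sphere (γ t) (C * infDist (γ t) Ωᶜ)) y ≠
          connectedComponentIn (Ω \ sphere (γ t) (C * infDist (γ t) Ωᶜ)) x₀

/-- The slice property with constant `C`. Lengths of curve portions are measured via the
Lebesgue measure of parameter preimages of arclength (`1`-Lipschitz) parametrizations. -/
def SliceProperty {n : ℕ} (Ω : Set (Eu n)) (C : ℝ) : Prop :=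
  ∀ x ∈ Ω, ∀ y ∈ Ω, ∃ (j : ℕ) (S : ℕ → Set (Eu n)) (L : ℝ) (γ : ℝ → Eu n),
    0 ≤ L ∧ LipschitzOnWith 1 γ (Set.Icc 0 L) ∧ γ 0 = x ∧ γ L = y ∧
    (∀ t ∈ Set.Icc (0:ℝ) L, γ t ∈ Ω) ∧
    (∀ i ≤ j, IsOpen (S i) ∧ S i ⊆ Ω) ∧
    (∀ i ≤ j, ∀ k ≤ j, i ≠ k → Disjoint (S i) (S k)) ∧
    x ∈ S 0 ∧ y ∈ S j ∧
    (∀ i, 0 < i → i < j →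
      connectedComponentIn (Ω \ closure (S i)) x ≠
        connectedComponentIn (Ω \ closure (S i)) y) ∧
    (∀ (LF : ℝ) (F : ℝ → Eu n), 0 ≤ LF → LipschitzOnWith 1 F (Set.Icc 0 LF) →
      F '' Set.Icc 0 LF ⊆ Ω → (∃ t ∈ Set.Icc (0:ℝ) LF, F t = x) →
      (∃ t ∈ Set.Icc (0:ℝ) LF, F t = y) →
      ∀ i, 0 < i → i < j →
        Metric.diam (S i) ≤ C * (volume {t : ℝ | t ∈ Set.Icc (0:ℝ) LF ∧ F t ∈ S i}).toReal) ∧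
    (∀ t ∈ Set.Icc (0:ℝ) L,
      ball (γ t) (C⁻¹ * infDist (γ t) Ωᶜ) ⊆ ⋃ i ∈ Finset.range (j + 1), S i) ∧
    (∀ i ≤ j, ∀ z ∈ γ '' Set.Icc (0:ℝ) L ∩ S i, Metric.diam (S i) ≤ C * infDist z Ωᶜ) ∧
    (∃ xi : ℕ → Eu n, xi 0 = x ∧ xi j = y ∧
      ∀ i ≤ j, xi i ∈ S i ∧ ball (xi i) (C⁻¹ * infDist (xi i) Ωᶜ) ⊆ S i)

/-- `v : Ω → ℝⁿ` is a distributional gradient of `u` on `U`. -/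
def HasDistribGradOn {n : ℕ} (U : Set (Eu n)) (u : Eu n → ℝ) (v : Eu n → Eu n) : Prop :=
  ∀ φ : Eu n → ℝ, ContDiff ℝ (⊤ : ℕ∞) φ → HasCompactSupport φ → tsupport φ ⊆ U →
    ∀ i : Fin n,
      ∫ x in U, u x * fderiv ℝ φ x (EuclideanSpace.single i 1) = - ∫ x in U, v x i * φ x

/-- `u ∈ Ẇ^{1,p}(U)` with distributional gradient `v ∈ L^p(U;ℝⁿ)`. -/
def MemW1p {n : ℕ} (U : Set (Eu n)) (p : ℝ) (u : Eu n → ℝ) (v : Eu n → Eu n) : Prop :=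
  LocallyIntegrableOn u U volume ∧ AEMeasurable v (volume.restrict U) ∧
    eLpNorm v (ENNReal.ofReal p) (volume.restrict U) < ⊤ ∧ HasDistribGradOn U u v

/-- `Ω` is a `Ẇ^{1,p}`-extension domain. -/
def IsW1pExtensionDomain {n : ℕ} (Ω : Set (Eu n)) (p : ℝ) : Prop :=
  ∃ C : ℝ, 0 < C ∧ ∀ u v, MemW1p Ω p u v →
    ∃ u' v', MemW1p (Set.univ) p u' v' ∧ (∀ᵐ x ∂(volume.restrict Ω), u' x = u x) ∧
      eLpNorm v' (ENNReal.ofReal p) volume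
        ≤ ENNReal.ofReal C * eLpNorm v (ENNReal.ofReal p) (volume.restrict Ω)

/-- The (uncentered over radii, centered) Hardy–Littlewood maximal function, `ℝ≥0∞`-valued. -/
def HLMax {n : ℕ} (g : Eu n → ℝ) (y : Eu n) : ℝ≥0∞ :=
  ⨆ (t : ℝ) (_ : 0 < t), (volume (ball y t))⁻¹ * ∫⁻ z in ball y t, ENNReal.ofReal |g z|


section part1
variable {n : ℕ}

lemma curve_contOn {D : Eu n → ℝ} (hD : LipschitzWith 1 D) {γ : ℝ → Eu n} {ℓ : ℝ}
    (hγ : LipschitzOnWith 1 γ (Icc 0 ℓ)) (hpos : ∀ t ∈ Icc (0:ℝ) ℓ, 0 < D (γ t)) :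
    ContinuousOn (fun t => (D (γ t))⁻¹) (Icc 0 ℓ) :=
  (hD.continuous.comp_continuousOn hγ.continuousOn).inv₀ (fun t ht => (hpos t ht).ne')

lemma lip_dist {D : Eu n → ℝ} (hD : LipschitzWith 1 D) (x y : Eu n) :
    D x ≤ D y + dist x y := by
  have := hD.dist_le_mul x y
  simp only [NNReal.coe_one, one_mul] at this
  rw [Real.dist_eq] at this
  linarith [(abs_le.1 this).2]

lemma chain_of_curve {D : Eu n → ℝ} (hD : LipschitzWith 1 D) {γ : ℝ → Eu n} {ℓ : ℝ}
    (hγ : LipschitzOnWith 1 γ (Icc 0 ℓ)) (hpos : ∀ t ∈ Icc (0:ℝ) ℓ, 0 < D (γ t))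
    {ε : ℝ} (hε : 0 < ε) : ∀ m : ℕ, ∀ a ∈ Icc (0:ℝ) ℓ,
      ∫ t in a..ℓ, (D (γ t))⁻¹ ≤ m * (ε / (1 + ε)) →
      ∃ M : ℕ, M ≤ m + 1 ∧ ∃ z : ℕ → Eu n, z 0 = γ a ∧ z M = γ ℓ ∧
        (∀ i ≤ M, z i ∈ γ '' Icc 0 ℓ) ∧ ∀ i < M, dist (z i) (z (i + 1)) ≤ ε * D (z i) := by
  have hcont := curve_contOn hD hγ hpos
  have hIntg : ∀ a ∈ Icc (0:ℝ) ℓ, ∀ b ∈ Icc (0:ℝ) ℓ,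
      IntervalIntegrable (fun t => (D (γ t))⁻¹) volume a b := by
    intro a ha b hb
    apply ContinuousOn.intervalIntegrable
    exact hcont.mono (by
      intro t ht
      rw [mem_uIcc] at ht
      constructor
      · rcases ht with h | h <;> linarith [ha.1, hb.1, h.1]
      · rcases ht with h | h <;> linarith [ha.2, hb.2, h.2])
  have hdist : ∀ a ∈ Icc (0:ℝ) ℓ, ∀ b ∈ Icc (0:ℝ) ℓ, dist (γ a) (γ b) ≤ |a - b| := by
    intro a ha b hb
    have := hγ.dist_le_mul a ha b hb
    simpa [Real.dist_eq] using this
  -- jump directly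
  have hjump : ∀ m : ℕ, ∀ a ∈ Icc (0:ℝ) ℓ, ℓ - a ≤ ε * D (γ a) →
      ∃ M : ℕ, M ≤ m + 1 ∧ ∃ z : ℕ → Eu n, z 0 = γ a ∧ z M = γ ℓ ∧
        (∀ i ≤ M, z i ∈ γ '' Icc 0 ℓ) ∧ ∀ i < M, dist (z i) (z (i + 1)) ≤ ε * D (z i) := by
    intro m a ha h
    have hl : ℓ ∈ Icc (0:ℝ) ℓ := ⟨ha.1.trans ha.2, le_rfl⟩
    refine ⟨1, by omega, fun i => if i = 0 then γ a else γ ℓ, by simp, by simp, ?_, ?_⟩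
    · intro i _
      by_cases hi : i = 0
      · simp only [hi, if_true]; exact mem_image_of_mem _ ha
      · simp only [hi, if_false]; exact mem_image_of_mem _ hl
    · intro i hi
      have : i = 0 := by omega
      subst this
      simp only [if_true, zero_add, one_ne_zero, if_false]
      have := hdist a ha ℓ hl
      rw [abs_sub_comm, abs_of_nonneg (by linarith [ha.2])] at this
      linarith
  have hcons : ∀ a ∈ Icc (0:ℝ) ℓ, ε * D (γ a) < ℓ - a →
      a + ε * D (γ a) ∈ Icc (0:ℝ) ℓ ∧
      ε / (1 + ε) ≤ ∫ t in a..(a + ε * D (γ a)), (D (γ t))⁻¹ := by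
    intro a ha h
    have hp := hpos a ha
    have hεd : 0 < ε * D (γ a) := mul_pos hε hp
    have hb : a + ε * D (γ a) ∈ Icc (0:ℝ) ℓ := ⟨by linarith [ha.1], by linarith⟩
    refine ⟨hb, ?_⟩
    have h1 : ∫ t in a..(a + ε * D (γ a)), ((1 + ε) * D (γ a))⁻¹ ≤
        ∫ t in a..(a + ε * D (γ a)), (D (γ t))⁻¹ := by
      apply intervalIntegral.integral_mono_on (by linarith) (by simp) (hIntg a ha _ hb)
      intro t ht
      have ht' : t ∈ Icc (0:ℝ) ℓ := ⟨ha.1.trans ht.1, ht.2.trans hb.2⟩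
      apply inv_anti₀ (hpos t ht')
      have h2 := lip_dist hD (γ t) (γ a)
      have h3 := hdist t ht' a ha
      rw [abs_of_nonneg (by linarith [ht.1])] at h3
      linarith [ht.2]
    refine le_trans (le_of_eq ?_) h1
    rw [intervalIntegral.integral_const, smul_eq_mul]
    field_simp
    ring
  intro m
  induction m with
  | zero =>
    intro a ha h
    by_cases hc : ℓ - a ≤ ε * D (γ a)
    · exact hjump 0 a ha hc
    · exfalso
      push Not at hc
      obtain ⟨hb, h1⟩ := hcons a ha hc
      have hl : ℓ ∈ Icc (0:ℝ) ℓ := ⟨ha.1.trans ha.2, le_rfl⟩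
      rw [← intervalIntegral.integral_add_adjacent_intervals (hIntg a ha _ hb) (hIntg _ hb ℓ hl)] at h
      have h2 : 0 ≤ ∫ t in (a + ε * D (γ a))..ℓ, (D (γ t))⁻¹ := by
        apply intervalIntegral.integral_nonneg hb.2
        intro t ht
        exact inv_nonneg.2 (hpos t ⟨hb.1.trans ht.1, ht.2⟩).le
      have : 0 < ε / (1 + ε) := by positivity
      simp at h
      linarith
  | succ m ih =>
    intro a ha h
    by_cases hc : ℓ - a ≤ ε * D (γ a)
    · exact hjump _ a ha hc
    · push Not at hc
      obtain ⟨hb, h1⟩ := hcons a ha hc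
      have hl : ℓ ∈ Icc (0:ℝ) ℓ := ⟨ha.1.trans ha.2, le_rfl⟩
      rw [← intervalIntegral.integral_add_adjacent_intervals (hIntg a ha _ hb) (hIntg _ hb ℓ hl)] at h
      push_cast at h
      obtain ⟨M, hM, z, hz0, hzM, hzm, hzd⟩ := ih _ hb (by linarith)
      refine ⟨M + 1, by omega, fun i => Nat.casesOn i (γ a) z, rfl, hzM, ?_, ?_⟩
      · intro i hi
        cases i with
        | zero => exact mem_image_of_mem _ ha
        | succ i => exact hzm i (by omega)
      · intro i hi
        cases i with
        | zero =>
          show dist (γ a) (z 0) ≤ ε * D (γ a)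
          rw [hz0]
          have := hdist a ha _ hb
          rw [abs_sub_comm, abs_of_nonneg (by linarith [mul_pos hε (hpos a ha)])] at this
          linarith
        | succ i => exact hzd i (by omega)

/-- Minimal chains: non-consecutive balls are disjoint. -/
lemma min_chain {D : Eu n → ℝ} {Ω : Set (Eu n)} {ε : ℝ} {x y : Eu n} {M₀ : ℕ}
    (h : ∃ z : ℕ → Eu n, z 0 = x ∧ z M₀ = y ∧ (∀ i ≤ M₀, z i ∈ Ω) ∧
      ∀ i < M₀, dist (z i) (z (i + 1)) < ε * (D (z i) + D (z (i + 1)))) :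
    ∃ M ≤ M₀, ∃ z : ℕ → Eu n, z 0 = x ∧ z M = y ∧ (∀ i ≤ M, z i ∈ Ω) ∧
      (∀ i < M, dist (z i) (z (i + 1)) < ε * (D (z i) + D (z (i + 1)))) ∧
      ∀ i j, i + 2 ≤ j → j ≤ M → ε * (D (z i) + D (z j)) ≤ dist (z i) (z j) := by
  classical
  let P : ℕ → Prop := fun M => ∃ z : ℕ → Eu n, z 0 = x ∧ z M = y ∧ (∀ i ≤ M, z i ∈ Ω) ∧
      ∀ i < M, dist (z i) (z (i + 1)) < ε * (D (z i) + D (z (i + 1)))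
  have hP : ∃ M, P M := ⟨M₀, h⟩
  refine ⟨Nat.find hP, Nat.find_min' hP h, ?_⟩
  obtain ⟨z, h0, h1, h2, h3⟩ := Nat.find_spec hP
  refine ⟨z, h0, h1, h2, h3, ?_⟩
  intro i j hij hj
  by_contra hc
  push Not at hc
  set M := Nat.find hP
  have hlt : M - (j - i - 1) < M := by omega
  apply Nat.find_min hP hlt
  refine ⟨fun k => if k ≤ i then z k else z (k + (j - i - 1)), ?_, ?_, ?_, ?_⟩
  · simp [h0]
  · have h5 : ¬ (M - (j - i - 1) ≤ i) := by omega
    simp only [h5, if_false]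
    rw [← h1]; congr 1; omega
  · intro k hk
    by_cases hki : k ≤ i
    · simp only [hki, if_true]; exact h2 _ (by omega)
    · simp only [hki, if_false]; exact h2 _ (by omega)
  · intro k hk
    by_cases hki : k + 1 ≤ i
    · have : k ≤ i := by omega
      simp only [hki, this, if_true]; exact h3 _ (by omega)
    · by_cases hk' : k ≤ i
      · have : k = i := by omega
        subst this
        simp only [hk', hki, if_true, if_false]
        have : k + 1 + (j - k - 1) = j := by omega
        rw [this]; exact hc
      · simp only [hk', hki, if_false]
        have : k + 1 + (j - i - 1) = (k + (j - i - 1)) + 1 := by omega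
        rw [this]; exact h3 _ (by omega)

/-- Few bad annuli. -/
lemma few_bad {D : Eu n → ℝ} (hD : LipschitzWith 1 D) {γ : ℝ → Eu n} {ℓ : ℝ} (hℓ : 0 ≤ ℓ)
    (hγ : LipschitzOnWith 1 γ (Icc 0 ℓ)) (hpos : ∀ t ∈ Icc (0:ℝ) ℓ, 0 < D (γ t))
    {c : ℝ} (hc : 0 < c) (I : Finset ℕ)
    (hI : ∀ i ∈ I, 2 * (1/2:ℝ)^i ≤ dist (γ ℓ) (γ 0))
    (hbad : ∀ i ∈ I, ∀ t ∈ Icc (0:ℝ) ℓ, (1/2:ℝ)^i < dist (γ t) (γ 0) →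
      dist (γ t) (γ 0) < 2 * (1/2:ℝ)^i → D (γ t) < c * (1/2:ℝ)^i) :
    (I.card : ℝ) ≤ c * ∫ t in (0:ℝ)..ℓ, (D (γ t))⁻¹ := by
  have hcont := curve_contOn hD hγ hpos
  set h : ℝ → ℝ := fun t => dist (γ t) (γ 0) with hh
  have hlip : LipschitzOnWith 1 h (Icc 0 ℓ) := by
    apply LipschitzOnWith.of_dist_le_mul
    intro a ha b hb
    refine le_trans ?_ (hγ.dist_le_mul a ha b hb)
    rw [Real.dist_eq]
    exact abs_dist_sub_le _ _ _
  set T : ℕ → Set ℝ := fun i => Icc 0 ℓ ∩ h ⁻¹' Ioo ((1/2:ℝ)^i) (2 * (1/2:ℝ)^i) with hT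
  have hTm : ∀ i, MeasurableSet (T i) := by
    intro i
    obtain ⟨U, hU, hU'⟩ := (_root_.continuousOn_iff'.1 hlip.continuousOn) (Ioo ((1/2:ℝ)^i) (2 * (1/2:ℝ)^i)) isOpen_Ioo
    have : T i = U ∩ Icc 0 ℓ := by rw [← hU', inter_comm]
    rw [this]
    exact hU.measurableSet.inter measurableSet_Icc
  have hTv : ∀ i ∈ I, ENNReal.ofReal ((1/2:ℝ)^i) ≤ volume (T i) := by
    intro i hi
    have h1 : Ioo ((1/2:ℝ)^i) (2 * (1/2:ℝ)^i) ⊆ h '' T i := by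
      intro r hr
      have h2 : r ∈ h '' Icc 0 ℓ := by
        have := intermediate_value_Icc hℓ hlip.continuousOn
        apply this
        constructor
        · simp only [hh, dist_self]; have : (0:ℝ) < (1/2)^i := by positivity
          linarith [hr.1]
        · have := hI i hi
          simp only [hh]; linarith [hr.2]
      obtain ⟨t, ht, rfl⟩ := h2
      exact ⟨t, ⟨ht, hr⟩, rfl⟩
    have h2 : volume (h '' T i) ≤ volume (T i) := by
      have := (hlip.mono (inter_subset_left : T i ⊆ Icc 0 ℓ)).hausdorffMeasure_image_le (d := 1) zero_le_one
      rw [hausdorffMeasure_real, ENNReal.coe_one, ENNReal.one_rpow, one_mul] at this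
      exact this
    have h3 := (measure_mono h1).trans h2
    rw [Real.volume_Ioo] at h3
    have h4 : 2 * (1/2:ℝ)^i - (1/2:ℝ)^i = (1/2:ℝ)^i := by ring
    rwa [h4] at h3
  have hdisj : Set.PairwiseDisjoint (I : Set ℕ) T := by
    have key : ∀ i j : ℕ, i < j → Disjoint (T i) (T j) := by
      intro i j hij
      rw [Set.disjoint_left]
      rintro t ⟨_, ht⟩ ⟨_, ht'⟩
      have h1 : (1/2:ℝ)^j ≤ (1/2:ℝ)^(i+1) :=
        pow_le_pow_of_le_one (by norm_num) (by norm_num) hij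
      rw [pow_succ] at h1
      have := ht.1; have := ht'.2
      linarith
    intro i _ j _ hij
    rcases lt_or_gt_of_ne hij with h | h
    · exact key i j h
    · exact (key j i h).symm
  have hlow : ∀ i ∈ I, ENNReal.ofReal c⁻¹ ≤ ∫⁻ t in T i, ENNReal.ofReal (D (γ t))⁻¹ := by
    intro i hi
    have hr : (0:ℝ) < (1/2)^i := by positivity
    calc ENNReal.ofReal c⁻¹ = ENNReal.ofReal (c * (1/2:ℝ)^i)⁻¹ * ENNReal.ofReal ((1/2:ℝ)^i) := by
          rw [← ENNReal.ofReal_mul (by positivity)]; congr 1; field_simp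
      _ ≤ ENNReal.ofReal (c * (1/2:ℝ)^i)⁻¹ * volume (T i) := by gcongr; exact hTv i hi
      _ = ∫⁻ t in T i, ENNReal.ofReal (c * (1/2:ℝ)^i)⁻¹ := by rw [setLIntegral_const]
      _ ≤ _ := by
        apply setLIntegral_mono' (hTm i)
        rintro t ⟨ht, ht'⟩
        apply ENNReal.ofReal_le_ofReal
        exact inv_anti₀ (hpos t ht) (hbad i hi t ht ht'.1 ht'.2).le
  have hsum : ∑ i ∈ I, ENNReal.ofReal c⁻¹ ≤ ∫⁻ t in Icc 0 ℓ, ENNReal.ofReal (D (γ t))⁻¹ := by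
    refine (Finset.sum_le_sum hlow).trans ?_
    rw [← lintegral_biUnion_finset hdisj (fun i _ => hTm i)]
    apply lintegral_mono_set
    intro t ht
    simp only [mem_iUnion] at ht
    obtain ⟨i, _, ht⟩ := ht
    exact ht.1
  have hI2 : ∫⁻ t in Icc 0 ℓ, ENNReal.ofReal (D (γ t))⁻¹ =
      ENNReal.ofReal (∫ t in (0:ℝ)..ℓ, (D (γ t))⁻¹) := by
    rw [intervalIntegral.integral_of_le hℓ, ← integral_Icc_eq_integral_Ioc,
      ofReal_integral_eq_lintegral_ofReal hcont.integrableOn_Icc]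
    filter_upwards [self_mem_ae_restrict measurableSet_Icc] with t ht
    exact inv_nonneg.2 (hpos t ht).le
  rw [hI2, Finset.sum_const, nsmul_eq_mul] at hsum
  have hnn : 0 ≤ ∫ t in (0:ℝ)..ℓ, (D (γ t))⁻¹ := by
    apply intervalIntegral.integral_nonneg hℓ
    intro t ht
    exact inv_nonneg.2 (hpos t ht).le
  have h4 : ENNReal.ofReal ((I.card : ℝ) * c⁻¹) ≤
      ENNReal.ofReal (∫ t in (0:ℝ)..ℓ, (D (γ t))⁻¹) := by
    rw [ENNReal.ofReal_mul (by positivity), ENNReal.ofReal_natCast]; exact hsum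
  rw [ENNReal.ofReal_le_ofReal_iff hnn, ← div_eq_mul_inv, div_le_iff₀ hc] at h4
  linarith

end part1

section part2
variable {n : ℕ}

/-- `x` and `y` are joined by a `1`-Lipschitz curve in `Ω`. -/
def LipJoined (Ω : Set (Eu n)) (x y : Eu n) : Prop :=
  ∃ ℓ : ℝ, 0 ≤ ℓ ∧ ∃ γ : ℝ → Eu n, LipschitzOnWith 1 γ (Set.Icc 0 ℓ) ∧ γ 0 = x ∧ γ ℓ = y ∧
    (∀ t ∈ Set.Icc (0:ℝ) ℓ, γ t ∈ Ω)

lemma lipJoined_convex {Ω S : Set (Eu n)} (hS : Convex ℝ S) (hSΩ : S ⊆ Ω) {a b : Eu n}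
    (ha : a ∈ S) (hb : b ∈ S) : LipJoined Ω a b := by
  rcases eq_or_ne a b with rfl | hab
  · refine ⟨0, le_rfl, fun _ => a, ?_, rfl, rfl, fun _ _ => hSΩ ha⟩
    exact (LipschitzWith.const a).weaken zero_le_one |>.lipschitzOnWith
  have hd : 0 < dist a b := dist_pos.2 hab
  refine ⟨dist a b, hd.le, fun t => AffineMap.lineMap a b (t / dist a b), ?_, by simp, ?_, ?_⟩
  · apply LipschitzOnWith.of_dist_le_mul
    intro s _ t _
    rw [dist_lineMap_lineMap, Real.dist_eq, Real.dist_eq, ← sub_div, abs_div, abs_of_pos hd]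
    simp only [NNReal.coe_one, one_mul]
    rw [div_mul_cancel₀ _ hd.ne']
  · simp [div_self hd.ne']
  · intro t ht
    apply hSΩ
    apply hS.lineMap_mem ha hb
    exact ⟨div_nonneg ht.1 hd.le, (div_le_one hd).2 ht.2⟩

lemma lipJoined_trans {Ω : Set (Eu n)} {a b c : Eu n} (h1 : LipJoined Ω a b)
    (h2 : LipJoined Ω b c) : LipJoined Ω a c := by
  obtain ⟨l1, hl1, γ, hγ, ha, hb, hm⟩ := h1
  obtain ⟨l2, hl2, η, hη, hb', hc, hm'⟩ := h2
  refine ⟨l1 + l2, by positivity, fun t => if t ≤ l1 then γ t else η (t - l1), ?_, ?_, ?_, ?_⟩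
  · have key : ∀ s ∈ Icc (0:ℝ) (l1 + l2), ∀ t ∈ Icc (0:ℝ) (l1 + l2), s ≤ t →
        dist (if s ≤ l1 then γ s else η (s - l1)) (if t ≤ l1 then γ t else η (t - l1)) ≤ t - s := by
      intro s hs t ht hst
      by_cases h1 : t ≤ l1
      · have h0 : s ≤ l1 := hst.trans h1
        simp only [h0, h1, if_true]
        have := hγ.dist_le_mul s ⟨hs.1, h0⟩ t ⟨ht.1, h1⟩
        rw [Real.dist_eq, abs_sub_comm, abs_of_nonneg (by linarith)] at this
        simpa using this
      · push Not at h1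
        by_cases h0 : s ≤ l1
        · simp only [h0, h1.not_ge, if_true, if_false]
          have e1 := hγ.dist_le_mul s ⟨hs.1, h0⟩ l1 ⟨hl1, le_rfl⟩
          have e2 := hη.dist_le_mul 0 ⟨le_rfl, hl2⟩ (t - l1) ⟨by linarith, by linarith [ht.2]⟩
          rw [Real.dist_eq, abs_sub_comm, abs_of_nonneg (by linarith)] at e1
          rw [Real.dist_eq, abs_sub_comm, abs_of_nonneg (by linarith)] at e2
          simp only [NNReal.coe_one, one_mul] at e1 e2
          have e3 := dist_triangle (γ s) (γ l1) (η (t - l1))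
          rw [hb, ← hb'] at e3 
          rw [hb, ← hb'] at e1
          linarith
        · simp only [h0, h1.not_ge, if_false]
          push Not at h0
          have e2 := hη.dist_le_mul (s - l1) ⟨by linarith, by linarith [hs.2]⟩ (t - l1) ⟨by linarith, by linarith [ht.2]⟩
          rw [Real.dist_eq, abs_sub_comm, abs_of_nonneg (by linarith)] at e2
          simp only [NNReal.coe_one, one_mul] at e2
          linarith
    apply LipschitzOnWith.of_dist_le_mul
    intro s hs t ht
    simp only [NNReal.coe_one, one_mul]
    rcases le_total s t with h | h
    · rw [Real.dist_eq, abs_sub_comm, abs_of_nonneg (by linarith)]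
      exact key s hs t ht h
    · rw [Real.dist_eq, abs_of_nonneg (by linarith), dist_comm]
      exact key t ht s hs h
  · simp [hl1, ha]
  · by_cases h : l1 + l2 ≤ l1
    · have : l2 = 0 := by linarith
      subst this
      simp [hb, ← hc, ← hb']
    · simp [hc]
      intro h'
      exact absurd (by linarith) h
  · intro t ht
    by_cases h : t ≤ l1
    · simp only [h, if_true]; exact hm t ⟨ht.1, h⟩
    · simp only [h, if_false]; push Not at h; exact hm' _ ⟨by linarith, by linarith [ht.2]⟩

lemma lipJoined_of_domain {Ω : Set (Eu n)} (ho : IsOpen Ω) (hc : IsPreconnected Ω) {x y : Eu n}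
    (hx : x ∈ Ω) (hy : y ∈ Ω) : LipJoined Ω x y := by
  refine hc.induction₂' (LipJoined Ω) ?_ ?_ hx hy
  · intro x hx
    obtain ⟨r, hr, hb⟩ := Metric.isOpen_iff.1 ho x hx
    filter_upwards [mem_nhdsWithin_of_mem_nhds (ball_mem_nhds x hr)] with y hy
    exact ⟨lipJoined_convex (convex_ball x r) hb (mem_ball_self hr) hy,
      lipJoined_convex (convex_ball x r) hb hy (mem_ball_self hr)⟩
  · intro x y z _ _ _ h1 h2
    exact lipJoined_trans h1 h2

/-! ### The weights -/

/-- Boundary layer at scale `2^{-i}`. -/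
def lay (D : Eu n → ℝ) (c : ℝ) (i : ℕ) : Set (Eu n) :=
  {y | c * (1/2:ℝ)^i ≤ D y ∧ D y ≤ 3 * (1/2:ℝ)^i}

/-- Enlarged layer. -/
def lay' (D : Eu n → ℝ) (c : ℝ) (i : ℕ) : Set (Eu n) :=
  {y | c / 2 * (1/2:ℝ)^i ≤ D y ∧ D y ≤ 4 * (1/2:ℝ)^i}

open Classical in
/-- Lipschitz cutoff near a layer. -/
def cut (D : Eu n → ℝ) (c : ℝ) (i : ℕ) (x : Eu n) : ℝ :=
  if (lay D c i).Nonempty then max 0 (1 - infDist x (lay D c i) / (4 * (1/2:ℝ)^i)) else 0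

/-- Sum of cutoffs. -/
def cutSum (D : Eu n → ℝ) (c : ℝ) (j : ℕ) (x : Eu n) : ℝ := ∑ i ∈ Finset.range j, cut D c i x

lemma cut_nonneg (D : Eu n → ℝ) (c : ℝ) (i : ℕ) (x : Eu n) : 0 ≤ cut D c i x := by
  unfold cut; split_ifs <;> simp

lemma cut_le_one (D : Eu n → ℝ) (c : ℝ) (i : ℕ) (x : Eu n) : cut D c i x ≤ 1 := by
  unfold cut; split_ifs
  · apply max_le zero_le_one
    have : 0 ≤ infDist x (lay D c i) / (4 * (1/2:ℝ)^i) := div_nonneg infDist_nonneg (by positivity)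
    linarith
  · exact zero_le_one

lemma cut_lip (D : Eu n → ℝ) (c : ℝ) (i : ℕ) (x y : Eu n) :
    cut D c i x ≤ cut D c i y + dist x y / (4 * (1/2:ℝ)^i) := by
  have hr : (0:ℝ) < 4 * (1/2:ℝ)^i := by positivity
  have h0 : 0 ≤ dist x y / (4 * (1/2:ℝ)^i) := by positivity
  unfold cut; split_ifs
  · apply max_le
    · have := le_max_left 0 (1 - infDist y (lay D c i) / (4 * (1/2:ℝ)^i)); linarith
    · have := le_max_right 0 (1 - infDist y (lay D c i) / (4 * (1/2:ℝ)^i))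
      have h2 := infDist_le_infDist_add_dist (x := y) (y := x) (s := lay D c i)
      rw [dist_comm] at h2
      have h3 : infDist y (lay D c i) / (4 * (1/2:ℝ)^i) ≤
        infDist x (lay D c i) / (4 * (1/2:ℝ)^i) + dist x y / (4 * (1/2:ℝ)^i) := by
        rw [← add_div]; gcongr
      linarith
  · linarith

lemma cut_cont (D : Eu n → ℝ) (c : ℝ) (i : ℕ) : Continuous (cut D c i) := by
  unfold cut
  split_ifs
  · exact continuous_const.max (continuous_const.sub ((continuous_infDist_pt _).div_const _))
  · exact continuous_const

lemma cutSum_cont (D : Eu n → ℝ) (c : ℝ) (i : ℕ) : Continuous (cutSum D c i) := by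
  unfold cutSum
  exact continuous_finsetSum _ (fun i _ => cut_cont D c i)

lemma cutSum_lip (D : Eu n → ℝ) (c : ℝ) (j : ℕ) (x y : Eu n) :
    cutSum D c j x ≤ cutSum D c j y + dist x y * 2 ^ j / 4 := by
  unfold cutSum
  induction j with
  | zero => simp; positivity
  | succ j ih =>
    rw [Finset.sum_range_succ, Finset.sum_range_succ]
    have := cut_lip D c j x y
    have h1 : dist x y / (4 * (1/2:ℝ)^j) = dist x y * 2^j / 4 := by
      rw [one_div, inv_pow]; field_simp
    rw [h1] at this
    rw [pow_succ]
    linarith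

lemma cutSum_mono (D : Eu n → ℝ) (c : ℝ) {i j : ℕ} (h : i ≤ j) (x : Eu n) :
    cutSum D c i x ≤ cutSum D c j x := by
  unfold cutSum
  apply Finset.sum_le_sum_of_subset_of_nonneg
  · simpa using h
  · intro k _ _; exact cut_nonneg _ _ _ _

lemma cut_pos_exists {D : Eu n → ℝ} {c : ℝ} {i : ℕ} {x : Eu n} (h : 0 < cut D c i x) :
    ∃ y ∈ lay D c i, dist x y < 4 * (1/2:ℝ)^i := by
  have hr : (0:ℝ) < 4 * (1/2:ℝ)^i := by positivity
  unfold cut at h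
  split_ifs at h with hne
  · rw [lt_max_iff] at h
    rcases h with h | h
    · exact absurd h (lt_irrefl _)
    · have : infDist x (lay D c i) < 4 * (1/2:ℝ)^i := by
        have : infDist x (lay D c i) / (4 * (1/2:ℝ)^i) < 1 := by linarith
        rwa [div_lt_one hr] at this
      exact (infDist_lt_iff hne).1 this
  · exact absurd h (lt_irrefl _)

lemma cut_ge_half {D : Eu n → ℝ} {c : ℝ} {i : ℕ} {x y : Eu n} (hy : y ∈ lay D c i)
    (h : dist x y ≤ 2 * (1/2:ℝ)^i) : 1/2 ≤ cut D c i x := by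
  have hr : (0:ℝ) < (1/2:ℝ)^i := by positivity
  unfold cut
  rw [if_pos ⟨y, hy⟩]
  refine le_trans ?_ (le_max_right _ _)
  have h1 := (infDist_le_dist_of_mem hy).trans h
  have : infDist x (lay D c i) / (4 * (1/2:ℝ)^i) ≤ 1/2 := by
    rw [div_le_iff₀ (by positivity)]; linarith
  linarith

lemma lay'_overlap {D : Eu n → ℝ} {c : ℝ} (hc : 0 < c) {K : ℕ} (hK : 8 / c < 2 ^ K)
    (j : ℕ) (y : Eu n) : ∑ i ∈ Finset.range j, (lay' D c i).indicator (fun _ => (1:ℝ≥0∞)) y ≤ K := by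
  classical
  have h1 : ∑ i ∈ Finset.range j, (lay' D c i).indicator (fun _ => (1:ℝ≥0∞)) y =
      (((Finset.range j).filter (fun i => y ∈ lay' D c i)).card : ℝ≥0∞) := by
    rw [Finset.card_filter, Nat.cast_sum]
    apply Finset.sum_congr rfl
    intro i _
    by_cases h : y ∈ lay' D c i <;> simp [h]
  rw [h1]
  norm_cast
  set F := (Finset.range j).filter (fun i => y ∈ lay' D c i) with hF
  rcases F.eq_empty_or_nonempty with he | hne
  · rw [he]; simp
  · set i1 := F.min' hne
    have hi1 : i1 ∈ F := F.min'_mem hne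
    have hsub : F ⊆ Finset.Ico i1 (i1 + K) := by
      intro i hi
      have hle : i1 ≤ i := F.min'_le i hi
      rw [Finset.mem_Ico]
      refine ⟨hle, ?_⟩
      by_contra hcon
      push Not at hcon
      have hm1 := (Finset.mem_filter.1 hi1).2.1
      have hm2 := (Finset.mem_filter.1 hi).2.2
      have h3 : (1/2:ℝ)^i ≤ (1/2:ℝ)^(i1 + K) :=
        pow_le_pow_of_le_one (by norm_num) (by norm_num) hcon
      rw [pow_add] at h3
      have h4 : c / 2 * (1/2:ℝ)^i1 ≤ 4 * ((1/2:ℝ)^i1 * (1/2:ℝ)^K) := by linarith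
      have h5 : (0:ℝ) < (1/2:ℝ)^i1 := by positivity
      have h6 : c / 2 ≤ 4 * (1/2:ℝ)^K := by
        by_contra h7
        push Not at h7
        nlinarith
      rw [one_div, inv_pow] at h6
      have h8 : (0:ℝ) < 2^K := by positivity
      rw [div_lt_iff₀ hc] at hK
      have h9 : c / 2 * 2^K ≤ 4 := by
        calc c / 2 * 2^K ≤ 4 * (2^K)⁻¹ * 2^K := by gcongr
          _ = 4 := by field_simp
      linarith
    have := Finset.card_le_card hsub
    simpa using this

end part2

section part3
variable {n : ℕ}

lemma vol_ball_eq (x : Eu n) {r : ℝ} (hr : 0 < r) :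
    volume (ball x r) = ENNReal.ofReal (r ^ n) * volume (ball (0 : Eu n) 1) := by
  have := Measure.addHaar_ball_of_pos (volume : Measure (Eu n)) x hr
  rwa [finrank_euclideanSpace_fin] at this

/-- The weight. -/
def wt (D : Eu n → ℝ) (c τ : ℝ) (j : ℕ) (x : Eu n) : ℝ≥0∞ :=
  ENNReal.ofReal (Real.exp (τ * cutSum D c j x))

lemma wt_meas (D : Eu n → ℝ) (c τ : ℝ) (j : ℕ) : Measurable (wt D c τ j) := by
  unfold wt
  have := (cutSum_cont D c j).measurable
  fun_prop

lemma wt_mono (D : Eu n → ℝ) (c : ℝ) {τ : ℝ} (hτ : 0 ≤ τ) {i j : ℕ} (h : i ≤ j) (x : Eu n) :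
    wt D c τ i x ≤ wt D c τ j x := by
  unfold wt
  gcongr
  exact cutSum_mono D c h x

lemma lay'_meas {D : Eu n → ℝ} (hD : LipschitzWith 1 D) (c : ℝ) (i : ℕ) :
    MeasurableSet (lay' D c i) := by
  have : lay' D c i = D ⁻¹' Icc (c / 2 * (1/2:ℝ)^i) (4 * (1/2:ℝ)^i) := rfl
  rw [this]
  exact hD.continuous.measurable measurableSet_Icc

lemma wt_transfer {D : Eu n → ℝ} (hD : LipschitzWith 1 D) {c τ : ℝ} (hc : 0 < c) (hc1 : c ≤ 1)
    (hτ : 0 < τ) (hτ1 : τ ≤ 1) (i : ℕ) :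
    ∫⁻ x, {x | 0 < cut D c i x}.indicator (wt D c τ i) x ≤
      ENNReal.ofReal (Real.exp 2 * (10 / c) ^ n) * ∫⁻ y in lay' D c i, wt D c τ i y := by
  set r : ℝ := (1/2:ℝ)^i with hrdef
  have hr : 0 < r := by positivity
  set v := volume (ball (0 : Eu n) (c / 2 * r)) with hv
  have hv0 : v ≠ 0 := (measure_ball_pos volume _ (by positivity)).ne'
  have hvt : v ≠ ⊤ := measure_ball_lt_top.ne
  set S : Set (Eu n × Eu n) := {p | dist p.1 p.2 < 5 * r} with hS
  have hSm : MeasurableSet S := (isOpen_lt continuous_dist continuous_const).measurableSet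
  set W := wt D c τ i with hW
  have hWm : Measurable W := wt_meas D c τ i
  set f : Eu n → Eu n → ℝ≥0∞ := fun x y => S.indicator (fun p => W p.2) (x, y) with hf
  have hfm : Measurable (Function.uncurry f) := by
    have : Function.uncurry f = S.indicator (fun p => W p.2) := by
      ext ⟨x, y⟩; rfl
    rw [this]
    exact (hWm.comp measurable_snd).indicator hSm
  have h1 : ∀ x, {x | 0 < cut D c i x}.indicator W x * v ≤
      ENNReal.ofReal (Real.exp 2) * ∫⁻ y in lay' D c i, f x y := by
    intro x
    by_cases hx : 0 < cut D c i x
    · rw [indicator_of_mem (by exact hx)]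
      obtain ⟨y, hy, hxy⟩ := cut_pos_exists hx
      have hsub : ball y (c / 2 * r) ⊆ lay' D c i := by
        intro z hz
        rw [mem_ball] at hz
        have e1 := lip_dist hD z y
        have e2 := lip_dist hD y z
        rw [dist_comm] at e2
        have e3 := hy.1
        have e4 := hy.2
        constructor
        · show c / 2 * r ≤ D z
          change c * r ≤ D y at e3
          linarith
        · show D z ≤ 4 * r
          change D y ≤ 3 * r at e4
          nlinarith
      have hvy : v = volume (ball y (c / 2 * r)) := by
        rw [hv, vol_ball_eq 0 (by positivity), vol_ball_eq y (by positivity)]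
      calc W x * v = ∫⁻ z in ball y (c / 2 * r), W x := by rw [setLIntegral_const, hvy]
        _ ≤ ∫⁻ z in ball y (c / 2 * r), ENNReal.ofReal (Real.exp 2) * f x z := by
          apply setLIntegral_mono' measurableSet_ball
          intro z hz
          rw [mem_ball] at hz
          have hxz : dist x z < 5 * r := by
            have := dist_triangle x y z
            rw [dist_comm y z] at this
            have h4 : c / 2 * r ≤ r := by nlinarith
            linarith
          have hfz : f x z = W z := by
            simp only [hf]
            rw [indicator_of_mem (by exact hxz)]
          rw [hfz, hW]
          unfold wt
          rw [← ENNReal.ofReal_mul (Real.exp_pos _).le, ← Real.exp_add]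
          apply ENNReal.ofReal_le_ofReal
          apply Real.exp_le_exp.2
          have e5 := cutSum_lip D c i x z
          have e6 : dist x z * 2 ^ i / 4 ≤ 5 / 4 := by
            have : r * 2^i = 1 := by rw [hrdef, ← mul_pow]; norm_num
            have h2 : (0:ℝ) < 2^i := by positivity
            nlinarith
          nlinarith
        _ = ENNReal.ofReal (Real.exp 2) * ∫⁻ z in ball y (c / 2 * r), f x z := by
          rw [lintegral_const_mul]
          exact hfm.of_uncurry_left
        _ ≤ _ := by
          gcongr
    · rw [indicator_of_notMem (by exact hx)]
      simp
  have h2 : (∫⁻ x, {x | 0 < cut D c i x}.indicator W x) * v ≤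
      ENNReal.ofReal (Real.exp 2) * ((ENNReal.ofReal ((10 / c) ^ n) * v) * ∫⁻ y in lay' D c i, W y) := by
    have hm1 : Measurable ({x | 0 < cut D c i x}.indicator W) :=
      hWm.indicator (isOpen_lt continuous_const (cut_cont D c i)).measurableSet
    rw [← lintegral_mul_const _ hm1]
    refine (lintegral_mono h1).trans ?_
    rw [lintegral_const_mul]
    swap
    · exact Measurable.lintegral_prod_right' (f := fun p : Eu n × Eu n => f p.1 p.2) hfm
    gcongr
    rw [lintegral_lintegral_swap hfm.aemeasurable, ← lintegral_const_mul _ hWm]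
    apply lintegral_mono
    intro y
    have : (fun x => f x y) = (ball y (5 * r)).indicator (fun _ => W y) := by
      ext x
      simp only [hf, indicator, hS, mem_ofPred_eq, mem_ball]
    show ∫⁻ x, f x y ≤ _
    rw [this, lintegral_indicator measurableSet_ball, setLIntegral_const, mul_comm]
    refine mul_le_mul_left ?_ _
    rw [hv, vol_ball_eq y (by positivity), vol_ball_eq 0 (r := c / 2 * r) (by positivity), ← mul_assoc,
      ← ENNReal.ofReal_mul (by positivity), ← mul_pow]
    apply le_of_eq
    congr 3
    field_simp
    ring
  rw [show ENNReal.ofReal (Real.exp 2) * ((ENNReal.ofReal ((10 / c) ^ n) * v) * ∫⁻ y in lay' D c i, W y)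
    = (ENNReal.ofReal (Real.exp 2 * (10 / c) ^ n) * ∫⁻ y in lay' D c i, W y) * v by
      rw [ENNReal.ofReal_mul (Real.exp_pos _).le]; ring] at h2
  exact (ENNReal.mul_le_mul_iff_left hv0 hvt).1 h2

lemma wt_bound {Ω : Set (Eu n)} (hfin : volume Ω < ⊤) {D : Eu n → ℝ}
    (hD : LipschitzWith 1 D) (hDΩ : ∀ x, 0 < D x → x ∈ Ω) {c : ℝ} (hc : 0 < c) (hc1 : c ≤ 1) :
    ∃ τ : ℝ, 0 < τ ∧ ∀ j, ∫⁻ x in Ω, wt D c τ j x ≤ 2 * volume Ω := by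
  obtain ⟨K, hK⟩ := pow_unbounded_of_one_lt (8 / c) (by norm_num : (1:ℝ) < 2)
  set C := Real.exp 2 * (10 / c) ^ n with hC
  have hC0 : 0 < C := by positivity
  set τ := min 1 (1 / (4 * C * (K + 1))) with hτdef
  have hτ : 0 < τ := lt_min one_pos (by positivity)
  have hτ1 : τ ≤ 1 := min_le_left _ _
  have hτ2 : 2 * τ * C * K ≤ 1/2 := by
    have : τ ≤ 1 / (4 * C * (K + 1)) := min_le_right _ _
    rw [le_div_iff₀ (by positivity)] at this
    nlinarith [mul_pos hτ hC0]
  refine ⟨τ, hτ, fun j => ?_⟩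
  set W := wt D c τ with hW
  have hlayΩ : ∀ i, lay' D c i ⊆ Ω := by
    intro i y hy
    apply hDΩ
    have : 0 < c / 2 * (1/2:ℝ)^i := by positivity
    exact this.trans_le hy.1
  have hstep : ∀ i, ∫⁻ x in Ω, W (i+1) x ≤ (∫⁻ x in Ω, W i x) +
      ENNReal.ofReal (2 * τ * C) * ∫⁻ y in lay' D c i, W i y := by
    intro i
    have hpt : ∀ x, W (i+1) x ≤ W i x +
        ENNReal.ofReal (2 * τ) * {x | 0 < cut D c i x}.indicator (W i) x := by
      intro x
      have hs : cutSum D c (i+1) x = cutSum D c i x + cut D c i x := by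
        unfold cutSum; rw [Finset.sum_range_succ]
      by_cases hx : 0 < cut D c i x
      · rw [indicator_of_mem (by exact hx), hW]
        unfold wt
        rw [← ENNReal.ofReal_mul (by positivity), ← ENNReal.ofReal_add (by positivity) (by positivity)]
        apply ENNReal.ofReal_le_ofReal
        rw [hs, mul_add, Real.exp_add]
        have h1 := cut_le_one D c i x
        have h2 : |τ * cut D c i x| ≤ 1 := by
          rw [abs_of_nonneg (by positivity)]; nlinarith
        have h3 := Real.abs_exp_sub_one_le h2
        rw [abs_of_nonneg (a := τ * cut D c i x) (by positivity)] at h3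
        have h4 := (abs_le.1 h3).2
        have h5 : Real.exp (τ * cut D c i x) ≤ 1 + 2 * τ := by nlinarith
        have h6 := Real.exp_pos (τ * cutSum D c i x)
        nlinarith
      · have h0 : cut D c i x = 0 := le_antisymm (not_lt.1 hx) (cut_nonneg _ _ _ _)
        rw [indicator_of_notMem (by exact hx), hW]
        unfold wt
        rw [hs, h0]; simp
    have hm1 : Measurable ({x | 0 < cut D c i x}.indicator (W i)) :=
      (wt_meas _ _ _ _).indicator (isOpen_lt continuous_const (cut_cont D c i)).measurableSet
    refine (lintegral_mono hpt).trans ?_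
    rw [lintegral_add_left (wt_meas _ _ _ _), lintegral_const_mul _ hm1]
    refine add_le_add le_rfl ?_
    calc ENNReal.ofReal (2 * τ) * ∫⁻ x in Ω, {x | 0 < cut D c i x}.indicator (W i) x
        ≤ ENNReal.ofReal (2 * τ) * ∫⁻ x, {x | 0 < cut D c i x}.indicator (W i) x := by
          exact mul_le_mul_right (setLIntegral_le_lintegral _ _) _
      _ ≤ ENNReal.ofReal (2 * τ) * (ENNReal.ofReal C * ∫⁻ y in lay' D c i, W i y) := by
          gcongr; exact wt_transfer hD hc hc1 hτ hτ1 i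
      _ = _ := by rw [← mul_assoc, ← ENNReal.ofReal_mul (by positivity)]
  have hsum : ∀ j, ∫⁻ x in Ω, W j x ≤ volume Ω +
      ENNReal.ofReal (2 * τ * C) * ∑ i ∈ Finset.range j, ∫⁻ y in lay' D c i, W i y := by
    intro j
    induction j with
    | zero =>
      have : ∀ x, W 0 x = 1 := by intro x; simp [hW, wt, cutSum]
      simp [this]
    | succ j ih =>
      refine (hstep j).trans ?_
      rw [Finset.sum_range_succ, mul_add, ← add_assoc]
      gcongr
  have hov : ∑ i ∈ Finset.range j, ∫⁻ y in lay' D c i, W i y ≤ K * ∫⁻ x in Ω, W j x := by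
    calc ∑ i ∈ Finset.range j, ∫⁻ y in lay' D c i, W i y
        ≤ ∑ i ∈ Finset.range j, ∫⁻ y in Ω, (lay' D c i).indicator (fun _ => (1:ℝ≥0∞)) y * W j y := by
          apply Finset.sum_le_sum
          intro i hi
          have h1 : (fun y => (lay' D c i).indicator (fun _ => (1:ℝ≥0∞)) y * W j y) =
              (lay' D c i).indicator (W j) := by
            ext y
            by_cases h : y ∈ lay' D c i <;> simp [h]
          rw [h1, lintegral_indicator (lay'_meas hD c i), Measure.restrict_restrict (lay'_meas hD c i),
            inter_eq_self_of_subset_left (hlayΩ i)]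
          apply lintegral_mono
          intro y
          exact wt_mono D c hτ.le (Finset.mem_range.1 hi).le y
      _ = ∫⁻ y in Ω, ∑ i ∈ Finset.range j, (lay' D c i).indicator (fun _ => (1:ℝ≥0∞)) y * W j y := by
          rw [lintegral_finsetSum]
          intro i _
          exact (measurable_const.indicator (lay'_meas hD c i)).mul (wt_meas _ _ _ _)
      _ ≤ ∫⁻ y in Ω, K * W j y := by
          apply lintegral_mono
          intro y
          dsimp only
          rw [← Finset.sum_mul]
          gcongr
          exact lay'_overlap hc hK j y
      _ = _ := by rw [lintegral_const_mul _ (wt_meas _ _ _ _)]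
  set X := ∫⁻ x in Ω, W j x with hX
  have hXfin : X ≠ ⊤ := by
    have : X ≤ ∫⁻ x in Ω, ENNReal.ofReal (Real.exp (τ * j)) := by
      apply lintegral_mono
      intro x
      simp only [hW, wt]
      gcongr
      unfold cutSum
      calc _ ≤ ∑ i ∈ Finset.range j, (1:ℝ) := Finset.sum_le_sum (fun i _ => cut_le_one D c i x)
        _ = j := by simp
    refine ne_top_of_le_ne_top ?_ this
    rw [setLIntegral_const]
    exact ENNReal.mul_ne_top ENNReal.ofReal_ne_top hfin.ne
  have hfinal : X ≤ volume Ω + ENNReal.ofReal (1/2) * X := by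
    refine (hsum j).trans ?_
    refine add_le_add le_rfl ?_
    calc _ ≤ ENNReal.ofReal (2 * τ * C) * (K * X) := by gcongr
      _ = ENNReal.ofReal (2 * τ * C * K) * X := by
        rw [ENNReal.ofReal_mul (p := 2 * τ * C) (by positivity), ENNReal.ofReal_natCast, ← mul_assoc]
      _ ≤ _ := by gcongr
  have hXr := ENNReal.ofReal_toReal hXfin
  have hVr := ENNReal.ofReal_toReal hfin.ne
  rw [← hXr, ← hVr] at hfinal ⊢
  rw [← ENNReal.ofReal_mul (by norm_num), ← ENNReal.ofReal_add (by positivity) (by positivity),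
    ENNReal.ofReal_le_ofReal_iff (by positivity)] at hfinal
  have h22 : 2 * ENNReal.ofReal (volume Ω).toReal = ENNReal.ofReal (2 * (volume Ω).toReal) := by
    rw [ENNReal.ofReal_mul (by norm_num), ENNReal.ofReal_ofNat]
  rw [h22]
  apply ENNReal.ofReal_le_ofReal
  linarith

end part3

section part4
variable {n : ℕ}

lemma cutSum_lower {D : Eu n → ℝ} (hD : LipschitzWith 1 D) {x₀ x : Eu n} {ℓ : ℝ} (hℓ : 0 ≤ ℓ)
    {γ : ℝ → Eu n} (hγ : LipschitzOnWith 1 γ (Icc 0 ℓ)) (h0 : γ 0 = x) (h1 : γ ℓ = x₀)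
    (hpos : ∀ t ∈ Icc (0:ℝ) ℓ, 0 < D (γ t)) {C : ℝ} (hC : 1 ≤ C)
    (hK : ∫ t in (0:ℝ)..ℓ, (D (γ t))⁻¹ ≤ C * Real.log (C / D x) + 1) {i0 j : ℕ}
    (hi0 : 2 * (1/2:ℝ)^i0 ≤ dist x₀ x) (hj : D x ≤ (1/2:ℝ)^j) (hj' : (1/2:ℝ)^(j+1) < D x) :
    ((j:ℝ)+1) / 4 - (i0 + C * Real.log C + 1) / 2 ≤ cutSum D (1 / (2 * C)) (j+1) x := by
  classical
  set c := 1 / (2 * C) with hc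
  have hC0 : 0 < C := by linarith
  have hc0 : 0 < c := by positivity
  set I := Finset.Icc i0 j with hI
  set P : ℕ → Prop := fun i => ∀ t ∈ Icc (0:ℝ) ℓ, (1/2:ℝ)^i < dist (γ t) (γ 0) →
      dist (γ t) (γ 0) < 2 * (1/2:ℝ)^i → D (γ t) < c * (1/2:ℝ)^i with hP
  have hbad := few_bad hD hℓ hγ hpos hc0 (I.filter P) (by
    intro i hi
    have hi' := (Finset.mem_Icc.1 (Finset.mem_filter.1 hi).1).1
    have : (1/2:ℝ)^i ≤ (1/2:ℝ)^i0 := pow_le_pow_of_le_one (by norm_num) (by norm_num) hi'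
    rw [h0, h1]; linarith) (by
    intro i hi
    exact (Finset.mem_filter.1 hi).2)
  have hgood : ∀ i ∈ I.filter (fun i => ¬ P i), 1/2 ≤ cut D c i x := by
    intro i hi
    have hi' := (Finset.mem_Icc.1 (Finset.mem_filter.1 hi).1).2
    have hnp := (Finset.mem_filter.1 hi).2
    simp only [hP] at hnp
    push Not at hnp
    obtain ⟨t, ht, e1, e2, e3⟩ := hnp
    have hij : (1/2:ℝ)^j ≤ (1/2:ℝ)^i := pow_le_pow_of_le_one (by norm_num) (by norm_num) hi'
    have e4 := lip_dist hD (γ t) (γ 0)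
    apply cut_ge_half (y := γ t)
    · refine ⟨e3, ?_⟩
      rw [h0] at e4 e2
      linarith
    · rw [h0, dist_comm] at e2; exact e2.le
  have hsum : (1/2:ℝ) * (I.filter (fun i => ¬ P i)).card ≤ cutSum D c (j+1) x := by
    unfold cutSum
    calc (1/2:ℝ) * (I.filter (fun i => ¬ P i)).card = ∑ i ∈ I.filter (fun i => ¬ P i), (1/2:ℝ) := by
          rw [Finset.sum_const, nsmul_eq_mul]; ring
      _ ≤ ∑ i ∈ I.filter (fun i => ¬ P i), cut D c i x := Finset.sum_le_sum hgood
      _ ≤ _ := by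
        apply Finset.sum_le_sum_of_subset_of_nonneg
        · intro i hi
          have := (Finset.mem_Icc.1 (Finset.mem_filter.1 hi).1).2
          rw [Finset.mem_range]; omega
        · intro i _ _; exact cut_nonneg _ _ _ _
  have hcard : ((I.filter P).card : ℝ) + (I.filter (fun i => ¬ P i)).card = I.card := by
    exact_mod_cast Finset.card_filter_add_card_filter_not (s := I) P
  have hIc : (j:ℝ) + 1 - i0 ≤ I.card := by
    rw [hI, Nat.card_Icc]
    have : j + 1 ≤ (j + 1 - i0) + i0 := by omega
    have : ((j + 1 : ℕ) : ℝ) ≤ ((j + 1 - i0 : ℕ) : ℝ) + (i0 : ℝ) := by exact_mod_cast this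
    push_cast at this
    linarith
  have hDx : 0 < D x := by rw [← h0]; exact hpos 0 ⟨le_rfl, hℓ⟩
  have hlog : Real.log (C / D x) ≤ Real.log C + (j + 1) := by
    rw [Real.log_div hC0.ne' hDx.ne']
    have h5 := Real.log_le_log (by positivity) hj'.le
    rw [Real.log_pow, one_div, Real.log_inv] at h5
    have h6 : Real.log 2 ≤ 1 := by linarith [Real.log_two_lt_d9]
    push_cast at h5
    have h7 : (0:ℝ) ≤ (j:ℝ) + 1 := by positivity
    nlinarith
  have hcC : c * C = 1/2 := by rw [hc]; field_simp
  have hlogC : 0 ≤ Real.log C := Real.log_nonneg hC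
  have hc2 : c ≤ 1/2 := by
    nlinarith
  have hfin : ((I.filter P).card : ℝ) ≤ (Real.log C + (j + 1)) / 2 + 1 / 2 := by
    calc ((I.filter P).card : ℝ) ≤ c * ∫ t in (0:ℝ)..ℓ, (D (γ t))⁻¹ := hbad
      _ ≤ c * (C * Real.log (C / D x) + 1) := by gcongr
      _ ≤ c * (C * (Real.log C + (j + 1)) + 1) := by gcongr
      _ = (c * C) * (Real.log C + (j + 1)) + c := by ring
      _ ≤ _ := by rw [hcC]; linarith
  nlinarith

lemma dist_integrable {Ω : Set (Eu n)} (hfin : volume Ω < ⊤) (hΩm : MeasurableSet Ω) {D : Eu n → ℝ}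
    (hD : LipschitzWith 1 D) (hDΩ : ∀ x, 0 < D x ↔ x ∈ Ω) {x₀ : Eu n} (hx₀ : x₀ ∈ Ω)
    {C : ℝ} (hC : 1 ≤ C)
    (hcur : ∀ x ∈ Ω, ∃ ℓ : ℝ, 0 ≤ ℓ ∧ ∃ γ : ℝ → Eu n, LipschitzOnWith 1 γ (Icc 0 ℓ) ∧
      γ 0 = x ∧ γ ℓ = x₀ ∧ (∀ t ∈ Icc (0:ℝ) ℓ, γ t ∈ Ω) ∧
      ∫ t in (0:ℝ)..ℓ, (D (γ t))⁻¹ ≤ C * Real.log (C / D x) + 1) :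
    ∃ β : ℝ, 0 < β ∧ ∫⁻ x in Ω, ENNReal.ofReal (D x ^ (-β)) < ⊤ := by
  have hC0 : 0 < C := by linarith
  have hc0 : 0 < 1 / (2 * C) := by positivity
  have hc1 : 1 / (2 * C) ≤ 1 := by rw [div_le_one (by positivity)]; linarith
  obtain ⟨τ, hτ, hW⟩ := wt_bound hfin hD (fun x => (hDΩ x).1) hc0 hc1
  set c := 1 / (2 * C) with hc
  have hD0 : 0 < D x₀ := (hDΩ x₀).2 hx₀
  obtain ⟨i0, hi0⟩ := exists_pow_lt_of_lt_one (show 0 < D x₀ / 4 by positivity)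
    (show (1/2:ℝ) < 1 by norm_num)
  set d0 := min 1 (D x₀ / 2) with hd0
  have hd0p : 0 < d0 := lt_min one_pos (by positivity)
  set b := (i0 + C * Real.log C + 1) / 2 with hb
  refine ⟨τ / 4, by positivity, ?_⟩
  have hpt : ∀ x ∈ Ω, ENNReal.ofReal (D x ^ (-(τ/4))) ≤ ENNReal.ofReal (d0 ^ (-(τ/4))) +
      ENNReal.ofReal (Real.exp (τ * b)) * ⨆ j, wt D c τ j x := by
    intro x hx
    have hDx : 0 < D x := (hDΩ x).2 hx
    by_cases hdx : d0 ≤ D x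
    · refine le_trans ?_ le_self_add
      apply ENNReal.ofReal_le_ofReal
      exact Real.rpow_le_rpow_of_nonpos hd0p hdx (by linarith)
    · push Not at hdx
      refine le_trans ?_ le_add_self
      have hdx1 : D x < 1 := hdx.trans_le (min_le_left _ _)
      have hdx2 : D x < D x₀ / 2 := hdx.trans_le (min_le_right _ _)
      obtain ⟨j, hj1, hj2⟩ := exists_nat_pow_near_of_lt_one hDx hdx1.le
        (show (0:ℝ) < 1/2 by norm_num) (show (1/2:ℝ) < 1 by norm_num)
      obtain ⟨ℓ, hℓ, γ, hγ, h0, h1, hm, hK⟩ := hcur x hx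
      have hlow := cutSum_lower hD hℓ hγ h0 h1 (fun t ht => (hDΩ _).2 (hm t ht)) hC hK
        (i0 := i0) (j := j) (by
          have := lip_dist hD x₀ x
          linarith) hj2 hj1
      calc ENNReal.ofReal (D x ^ (-(τ/4))) ≤
            ENNReal.ofReal (Real.exp (τ * b)) * wt D c τ (j+1) x := by
            unfold wt
            rw [← ENNReal.ofReal_mul (Real.exp_pos _).le, ← Real.exp_add]
            apply ENNReal.ofReal_le_ofReal
            rw [Real.rpow_def_of_pos hDx]
            apply Real.exp_le_exp.2
            have h5 := Real.log_le_log (by positivity) hj1.le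
            rw [Real.log_pow, one_div, Real.log_inv] at h5
            have h6 : Real.log 2 ≤ 1 := by linarith [Real.log_two_lt_d9]
            push_cast at h5
            have h7 : (0:ℝ) ≤ (j:ℝ) + 1 := by positivity
            have h8 : -((j:ℝ)+1) ≤ Real.log (D x) := by nlinarith
            nlinarith
        _ ≤ _ := by
          gcongr
          exact le_iSup (fun j => wt D c τ j x) (j+1)
  calc ∫⁻ x in Ω, ENNReal.ofReal (D x ^ (-(τ/4)))
      ≤ ∫⁻ x in Ω, (ENNReal.ofReal (d0 ^ (-(τ/4))) +
      ENNReal.ofReal (Real.exp (τ * b)) * ⨆ j, wt D c τ j x) := setLIntegral_mono' hΩm hpt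
    _ = ENNReal.ofReal (d0 ^ (-(τ/4))) * volume Ω +
      ENNReal.ofReal (Real.exp (τ * b)) * ∫⁻ x in Ω, ⨆ j, wt D c τ j x := by
      rw [lintegral_add_left measurable_const, setLIntegral_const, lintegral_const_mul]
      exact Measurable.iSup (fun j => wt_meas _ _ _ _)
    _ ≤ ENNReal.ofReal (d0 ^ (-(τ/4))) * volume Ω +
      ENNReal.ofReal (Real.exp (τ * b)) * (2 * volume Ω) := by
      gcongr
      rw [lintegral_iSup (fun j => wt_meas _ _ _ _)]
      · exact iSup_le hW
      · intro i j hij x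
        exact wt_mono D c hτ.le hij x
    _ < ⊤ := by
      have := hfin.ne
      have h2 : 2 * volume Ω ≠ ⊤ := ENNReal.mul_ne_top (by simp) this
      exact ENNReal.add_lt_top.2 ⟨ENNReal.mul_lt_top ENNReal.ofReal_lt_top hfin,
        ENNReal.mul_lt_top ENNReal.ofReal_lt_top h2.lt_top⟩

end part4

section part5
variable {n : ℕ}

/-- The reciprocal of the volume of the unit ball. -/
def kap (n : ℕ) : ℝ := (volume (ball (0 : Eu n) 1)).toReal⁻¹

lemma kap_pos : 0 < kap n := by
  unfold kap
  exact inv_pos.2 (ENNReal.toReal_pos (measure_ball_pos volume _ one_pos).ne' measure_ball_lt_top.ne)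

lemma good_pt {g : Eu n → ℝ} (hg : Measurable g) (hg0 : ∀ x, 0 ≤ g x) {N : Set (Eu n)}
    (hN : volume N = 0) {s p : ℝ} (hsp : s * p = n) (z : Eu n) {r : ℝ}
    (hr : 0 < r) : ∃ y ∈ ball z r, y ∉ N ∧
      ENNReal.ofReal ((r ^ s * g y) ^ p) ≤
        ENNReal.ofReal (kap n) * ∫⁻ x in ball z r, ENNReal.ofReal (g x ^ p) := by
  have hv0 := (measure_ball_pos volume (0 : Eu n) one_pos).ne'
  have hvt := (measure_ball_lt_top (μ := volume) (x := (0 : Eu n)) (r := 1)).ne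
  have hB0 := (measure_ball_pos volume z hr).ne'
  have hF : Measurable (fun x => ENNReal.ofReal (g x ^ p)) := by fun_prop
  haveI : IsFiniteMeasure (volume.restrict (ball z r)) :=
    ⟨by rw [Measure.restrict_apply_univ]; exact measure_ball_lt_top⟩
  obtain ⟨y, hy, hy'⟩ := exists_notMem_null_le_laverage (μ := volume.restrict (ball z r))
    (N := N ∪ (ball z r)ᶜ) (f := fun x => ENNReal.ofReal (g x ^ p))
    (by rw [Ne, Measure.restrict_eq_zero]; exact hB0) hF.aemeasurable (by
      apply measure_union_null
      · exact le_antisymm ((Measure.restrict_apply_le _ _).trans hN.le) bot_le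
      · rw [Measure.restrict_apply measurableSet_ball.compl]; simp)
  simp only [mem_union, mem_compl_iff, not_or, not_not] at hy
  refine ⟨y, hy.2, hy.1, ?_⟩
  rw [setLAverage_eq, vol_ball_eq z hr] at hy'
  have e1 : (r ^ s * g y) ^ p = r ^ n * g y ^ p := by
    rw [Real.mul_rpow (by positivity) (hg0 y), ← Real.rpow_mul hr.le, hsp, Real.rpow_natCast]
  have hrn : ENNReal.ofReal (r ^ n) ≠ 0 := by
    rw [Ne, ENNReal.ofReal_eq_zero]; push Not; positivity
  rw [e1, ENNReal.ofReal_mul (by positivity)]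
  have e2 : ENNReal.ofReal (kap n) = (volume (ball (0 : Eu n) 1))⁻¹ := by
    unfold kap
    rw [ENNReal.ofReal_inv_of_pos (ENNReal.toReal_pos hv0 hvt), ENNReal.ofReal_toReal hvt]
  rw [e2]
  calc ENNReal.ofReal (r ^ n) * ENNReal.ofReal (g y ^ p) ≤ ENNReal.ofReal (r ^ n) *
      ((∫⁻ x in ball z r, ENNReal.ofReal (g x ^ p)) /
        (ENNReal.ofReal (r ^ n) * volume (ball (0:Eu n) 1))) := by gcongr
    _ = (ENNReal.ofReal (r ^ n) * (ENNReal.ofReal (r ^ n))⁻¹) *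
        ((volume (ball (0 : Eu n) 1))⁻¹ * ∫⁻ x in ball z r, ENNReal.ofReal (g x ^ p)) := by
      rw [div_eq_mul_inv, ENNReal.mul_inv (Or.inl hrn) (Or.inl ENNReal.ofReal_ne_top)]
      ring
    _ = _ := by rw [ENNReal.mul_inv_cancel hrn ENNReal.ofReal_ne_top, one_mul]

lemma sum_bound {Ω : Set (Eu n)} {F : Eu n → ℝ≥0∞} (hF : ∫⁻ x in Ω, F x ≤ 1)
    {p q : ℝ} (hpq : p.HolderConjugate q) (L : ℕ) (B : ℕ → Set (Eu n)) (a : ℕ → ℝ)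
    (hBm : ∀ i < L, MeasurableSet (B i)) (hBΩ : ∀ i < L, B i ⊆ Ω)
    (hdisj : ∀ i j, i + 2 ≤ j → j < L → Disjoint (B i) (B j))
    (ha : ∀ i < L, 0 ≤ a i)
    (hab : ∀ i < L, ENNReal.ofReal (a i ^ p) ≤ ENNReal.ofReal (kap n) * ∫⁻ x in B i, F x) :
    ∑ i ∈ Finset.range L, a i ≤ (2 * kap n) ^ (1 / p) * (L : ℝ) ^ (1 / q) := by
  classical
  have hk := kap_pos (n := n)
  have hpar : ∀ (P : ℕ → Prop) [DecidablePred P], (∀ i j, P i → P j → i < j → i + 2 ≤ j) →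
      ∑ i ∈ (Finset.range L).filter P, ∫⁻ x in B i, F x ≤ 1 := by
    intro P _ hP
    have hd : Set.PairwiseDisjoint (((Finset.range L).filter P : Finset ℕ) : Set ℕ) B := by
      intro i hi j hj hij
      have hi' := Finset.mem_filter.1 (Finset.mem_coe.1 hi)
      have hj' := Finset.mem_filter.1 (Finset.mem_coe.1 hj)
      rcases lt_or_gt_of_ne hij with h | h
      · exact hdisj i j (hP i j hi'.2 hj'.2 h) (Finset.mem_range.1 hj'.1)
      · exact (hdisj j i (hP j i hj'.2 hi'.2 h) (Finset.mem_range.1 hi'.1)).symm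
    rw [← lintegral_biUnion_finset hd
      (fun i hi => hBm i (Finset.mem_range.1 (Finset.mem_filter.1 hi).1))]
    refine le_trans (lintegral_mono_set ?_) hF
    intro x hx
    simp only [mem_iUnion] at hx
    obtain ⟨i, hi, hx⟩ := hx
    exact hBΩ i (Finset.mem_range.1 (Finset.mem_filter.1 hi).1) hx
  have h2 : ∑ i ∈ Finset.range L, ∫⁻ x in B i, F x ≤ 2 := by
    rw [← Finset.sum_filter_add_sum_filter_not _ (fun i => Even i)]
    calc _ ≤ (1:ℝ≥0∞) + 1 := by
          apply add_le_add
          · apply hpar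
            intro i j hi hj hij
            obtain ⟨k, hk⟩ := hi; obtain ⟨l, hl⟩ := hj; omega
          · apply hpar
            intro i j hi hj hij
            rw [Nat.not_even_iff_odd] at hi hj
            obtain ⟨k, hk⟩ := hi; obtain ⟨l, hl⟩ := hj; omega
      _ = 2 := one_add_one_eq_two
  have h3 : ∑ i ∈ Finset.range L, a i ^ p ≤ 2 * kap n := by
    rw [← ENNReal.ofReal_le_ofReal_iff (by positivity), ENNReal.ofReal_sum_of_nonneg
      (fun i hi => Real.rpow_nonneg (ha i (Finset.mem_range.1 hi)) _)]
    calc ∑ i ∈ Finset.range L, ENNReal.ofReal (a i ^ p)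
        ≤ ∑ i ∈ Finset.range L, ENNReal.ofReal (kap n) * ∫⁻ x in B i, F x :=
          Finset.sum_le_sum (fun i hi => hab i (Finset.mem_range.1 hi))
      _ = ENNReal.ofReal (kap n) * ∑ i ∈ Finset.range L, ∫⁻ x in B i, F x := by
          rw [Finset.mul_sum]
      _ ≤ ENNReal.ofReal (kap n) * 2 := mul_le_mul_right h2 _
      _ = ENNReal.ofReal (2 * kap n) := by
          rw [mul_comm, ENNReal.ofReal_mul (by norm_num), ENNReal.ofReal_ofNat]
  have h4 := Real.inner_le_Lp_mul_Lq (Finset.range L) a (fun _ => (1:ℝ)) hpq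
  simp only [mul_one, abs_one, Real.one_rpow, Finset.sum_const, Finset.card_range, nsmul_eq_mul] at h4
  refine h4.trans ?_
  have h5 : ∑ i ∈ Finset.range L, |a i| ^ p = ∑ i ∈ Finset.range L, a i ^ p :=
    Finset.sum_congr rfl (fun i hi => by rw [abs_of_nonneg (ha i (Finset.mem_range.1 hi))])
  rw [h5]
  have h6 : 0 ≤ ∑ i ∈ Finset.range L, a i ^ p :=
    Finset.sum_nonneg (fun i hi => Real.rpow_nonneg (ha i (Finset.mem_range.1 hi)) _)
  have hp := hpq.pos
  gcongr

lemma telescope (f a : ℕ → ℝ) (A : ℝ) (hA : 0 ≤ A) (L : ℕ) (ha : ∀ i < L + 1, 0 ≤ a i)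
    (h : ∀ i < L, |f i - f (i+1)| ≤ A * (a i + a (i+1))) :
    |f 0 - f L| ≤ 2 * A * ∑ i ∈ Finset.range (L+1), a i := by
  have h1 : |f 0 - f L| ≤ ∑ i ∈ Finset.range L, |f i - f (i+1)| := by
    have := dist_le_range_sum_dist f L
    simpa [Real.dist_eq] using this
  have h2 : ∑ i ∈ Finset.range L, |f i - f (i+1)| ≤ ∑ i ∈ Finset.range L, A * (a i + a (i+1)) :=
    Finset.sum_le_sum (fun i hi => h i (Finset.mem_range.1 hi))
  rw [← Finset.mul_sum, Finset.sum_add_distrib] at h2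
  have h3 : ∑ i ∈ Finset.range L, a i ≤ ∑ i ∈ Finset.range (L+1), a i := by
    rw [Finset.sum_range_succ]; linarith [ha L (by omega)]
  have h4 : ∑ i ∈ Finset.range L, a (i+1) ≤ ∑ i ∈ Finset.range (L+1), a i := by
    rw [Finset.sum_range_succ']; linarith [ha 0 (by omega)]
  have h5 : A * (∑ i ∈ Finset.range L, a i + ∑ i ∈ Finset.range L, a (i+1)) ≤
      A * (∑ i ∈ Finset.range (L+1), a i + ∑ i ∈ Finset.range (L+1), a i) := by gcongr
  linarith

/-- `(k r)^s ≤ k r^s` bound turned into an estimate. -/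
lemma rpow_scale {s k r d : ℝ} (hs0 : 0 < s) (hs1 : s ≤ 1) (hk : 1 ≤ k) (hr : 0 ≤ r) (hd : 0 ≤ d)
    (h : d ≤ k * r) : d ^ s ≤ k * r ^ s := by
  calc d ^ s ≤ (k * r) ^ s := Real.rpow_le_rpow hd h hs0.le
    _ = k ^ s * r ^ s := Real.mul_rpow (by linarith) hr
    _ ≤ k * r ^ s := by
      gcongr
      calc k ^ s ≤ k ^ (1:ℝ) := Real.rpow_le_rpow_of_exponent_le hk hs1
        _ = k := Real.rpow_one k

/-- Setup for the pointwise estimates. -/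
structure HajSetup (n : ℕ) (Ω : Set (Eu n)) (D : Eu n → ℝ) (N : Set (Eu n)) (s p q : ℝ)
    (u g : Eu n → ℝ) : Prop where
  hD : LipschitzWith 1 D
  hDΩ : ∀ x, 0 < D x ↔ x ∈ Ω
  hs0 : 0 < s
  hs1 : s ≤ 1
  hsp : s * p = n
  hpq : p.HolderConjugate q
  hg : Measurable g
  hg0 : ∀ x, 0 ≤ g x
  hN : volume N = 0
  hF : ∫⁻ x in Ω, ENNReal.ofReal (g x ^ p) ≤ 1
  haj : ∀ x ∈ Ω, x ∉ N → ∀ y ∈ Ω, y ∉ N → dist x y < D x / 2 →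
    |u x - u y| ≤ dist x y ^ s * (g x + g y)

lemma HajSetup.ball_sub {Ω : Set (Eu n)} {D : Eu n → ℝ} {N : Set (Eu n)} {s p q : ℝ}
    {u g : Eu n → ℝ} (H : HajSetup n Ω D N s p q u g) {x y : Eu n} (h : dist y x < D x) :
    y ∈ Ω := by
  rw [← H.hDΩ]
  have := lip_dist H.hD x y
  rw [dist_comm] at this
  linarith

lemma HajSetup.step {Ω : Set (Eu n)} {D : Eu n → ℝ} {N : Set (Eu n)} {s p q : ℝ}
    {u g : Eu n → ℝ} (H : HajSetup n Ω D N s p q u g) {x y : Eu n} (hx : x ∈ Ω) (hxN : x ∉ N)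
    (hy : y ∈ Ω) (hyN : y ∉ N) (hd : dist x y < D x / 2) {k r r' : ℝ} (hk : 1 ≤ k) (hr : 0 ≤ r)
    (hr' : 0 ≤ r') (h : dist x y ≤ k * r) (h' : dist x y ≤ k * r') :
    |u x - u y| ≤ k * (r ^ s * g x + r' ^ s * g y) := by
  have h1 := H.haj x hx hxN y hy hyN hd
  have h2 := rpow_scale H.hs0 H.hs1 hk hr dist_nonneg h
  have h3 := rpow_scale H.hs0 H.hs1 hk hr' dist_nonneg h'
  have h4 := mul_le_mul_of_nonneg_right h2 (H.hg0 x)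
  have h5 := mul_le_mul_of_nonneg_right h3 (H.hg0 y)
  linarith

end part5

section part6
variable {n : ℕ}

/-- Good points in Whitney type balls. -/
def GoodSel (n : ℕ) (Ω : Set (Eu n)) (D : Eu n → ℝ) (N : Set (Eu n)) (s p : ℝ)
    (g : Eu n → ℝ) (Y : Eu n → Eu n) : Prop :=
  ∀ z ∈ Ω, Y z ∈ ball z (D z / 20) ∧ Y z ∉ N ∧
    ENNReal.ofReal (((D z / 20) ^ s * g (Y z)) ^ p) ≤
      ENNReal.ofReal (kap n) * ∫⁻ x in ball z (D z / 20), ENNReal.ofReal (g x ^ p)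

lemma exists_goodSel {Ω : Set (Eu n)} {D : Eu n → ℝ} {N : Set (Eu n)} {s p q : ℝ}
    {u g : Eu n → ℝ} (H : HajSetup n Ω D N s p q u g) : ∃ Y, GoodSel n Ω D N s p g Y := by
  have : ∀ z : Eu n, ∃ y, z ∈ Ω → y ∈ ball z (D z / 20) ∧ y ∉ N ∧
    ENNReal.ofReal (((D z / 20) ^ s * g y) ^ p) ≤
      ENNReal.ofReal (kap n) * ∫⁻ x in ball z (D z / 20), ENNReal.ofReal (g x ^ p) := by
    intro z
    by_cases hz : z ∈ Ω
    · have := (H.hDΩ z).2 hz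
      obtain ⟨y, h1, h2, h3⟩ := good_pt H.hg H.hg0 H.hN H.hsp z (r := D z / 20) (by linarith)
      exact ⟨y, fun _ => ⟨h1, h2, h3⟩⟩
    · exact ⟨z, fun h => absurd h hz⟩
  choose Y hY using this
  exact ⟨Y, fun z hz => hY z hz⟩

lemma chain_part {Ω : Set (Eu n)} {D : Eu n → ℝ} {N : Set (Eu n)} {s p q : ℝ}
    {u g : Eu n → ℝ} (H : HajSetup n Ω D N s p q u g) {Y : Eu n → Eu n}
    (hY : GoodSel n Ω D N s p g Y) {x y : Eu n} {M : ℕ} {z : ℕ → Eu n} (h0 : z 0 = x)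
    (hM : z M = y) (hz : ∀ i ≤ M, z i ∈ Ω)
    (hadj : ∀ i < M, dist (z i) (z (i + 1)) < 1 / 20 * (D (z i) + D (z (i + 1))))
    (hsep : ∀ i j, i + 2 ≤ j → j ≤ M → 1 / 20 * (D (z i) + D (z j)) ≤ dist (z i) (z j)) :
    |u (Y x) - u (Y y)| ≤ 10 * ((2 * kap n) ^ (1 / p) * ((M + 1 : ℕ) : ℝ) ^ (1 / q)) := by
  have hsum := sum_bound H.hF H.hpq (M + 1) (fun i => ball (z i) (D (z i) / 20))
    (fun i => (D (z i) / 20) ^ s * g (Y (z i))) (fun _ _ => measurableSet_ball)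
    (by
      intro i hi w hw
      have := (H.hDΩ _).2 (hz i (by omega))
      exact H.ball_sub (x := z i) (by rw [mem_ball] at hw; linarith))
    (by
      intro i j hij hj
      apply ball_disjoint_ball
      have := hsep i j hij (by omega)
      linarith)
    (by
      intro i hi
      have := (H.hDΩ _).2 (hz i (by omega))
      have := H.hg0 (Y (z i))
      positivity)
    (fun i hi => (hY _ (hz i (by omega))).2.2)
  have htel := telescope (fun i => u (Y (z i))) (fun i => (D (z i) / 20) ^ s * g (Y (z i))) 5
    (by norm_num) M (by
      intro i hi
      have := (H.hDΩ _).2 (hz i (by omega))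
      have := H.hg0 (Y (z i))
      positivity) (by
      intro i hi
      have hi1 := hz i (by omega)
      have hi2 := hz (i+1) (by omega)
      have d1 := (H.hDΩ _).2 hi1
      have d2 := (H.hDΩ _).2 hi2
      obtain ⟨a1, a2, -⟩ := hY _ hi1
      obtain ⟨b1, b2, -⟩ := hY _ hi2
      rw [mem_ball] at a1 b1
      have ha := hadj i hi
      have l1 := lip_dist H.hD (z (i+1)) (z i)
      have l2 := lip_dist H.hD (z i) (z (i+1))
      rw [dist_comm] at l1
      have l3 := lip_dist H.hD (z i) (Y (z i))
      rw [dist_comm] at l3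
      have t1 : dist (Y (z i)) (Y (z (i+1))) ≤ dist (Y (z i)) (z i) + dist (z i) (z (i+1)) +
        dist (Y (z (i+1))) (z (i+1)) := by
        have := dist_triangle4 (Y (z i)) (z i) (z (i+1)) (Y (z (i+1)))
        rwa [dist_comm (z (i+1)) (Y (z (i+1)))] at this
      exact H.step (H.ball_sub (x := z i) (by linarith)) a2 (H.ball_sub (x := z (i+1)) (by linarith))
        b2 (by linarith) (by norm_num) (by linarith) (by linarith) (by linarith) (by linarith))
  simp only [h0, hM] at htel
  linarith

lemma inner_part (hn : 2 ≤ n) {Ω : Set (Eu n)} {D : Eu n → ℝ} {N : Set (Eu n)} {s p q : ℝ}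
    {u g : Eu n → ℝ} (H : HajSetup n Ω D N s p q u g) {Y : Eu n → Eu n}
    (hY : GoodSel n Ω D N s p g Y) {x : Eu n} (hx : x ∈ Ω) (hxN : x ∉ N) {m : ℕ}
    (hm : (D x / 20 * (1 / 2) ^ m) ^ s * g x ≤ 1) :
    |u x - u (Y x)| ≤ 4 + 44 * ((2 * kap n) ^ (1 / p) * ((m + 1 : ℕ) : ℝ) ^ (1 / q)) := by
  have hDx := (H.hDΩ _).2 hx
  obtain ⟨e, he⟩ : ∃ e : Eu n, ‖e‖ = 1 :=
    ⟨EuclideanSpace.single ⟨0, by omega⟩ 1, by simp⟩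
  set ρ : ℕ → ℝ := fun i => D x / 20 * (1 / 2) ^ i with hρ
  have hρpos : ∀ i, 0 < ρ i := fun i => by simp only [hρ]; positivity
  have hρs : ∀ i, ρ (i+1) = ρ i / 2 := fun i => by simp only [hρ, pow_succ]; ring
  have hρ0 : ρ 0 = D x / 20 := by simp [hρ]
  have hρanti : Antitone ρ := antitone_nat_of_succ_le (fun i => by
    rw [hρs]; linarith [hρpos i])
  have hw : ∀ i, ∃ w ∈ ball (x + (3 / 4 * ρ i) • e) (ρ i / 4), w ∉ N ∧
      ENNReal.ofReal (((ρ i / 4) ^ s * g w) ^ p) ≤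
        ENNReal.ofReal (kap n) * ∫⁻ x in ball (x + (3 / 4 * ρ i) • e) (ρ i / 4),
          ENNReal.ofReal (g x ^ p) := fun i =>
    good_pt H.hg H.hg0 H.hN H.hsp _ (by linarith [hρpos i])
  choose w hwb hwN hwg using hw
  have hcen : ∀ i, dist (x + (3 / 4 * ρ i) • e) x = 3 / 4 * ρ i := fun i => by
    rw [dist_eq_norm, add_sub_cancel_left, norm_smul, he, mul_one, Real.norm_eq_abs,
      abs_of_pos (by linarith [hρpos i])]
  have hup : ∀ i, ∀ v ∈ ball (x + (3 / 4 * ρ i) • e) (ρ i / 4), dist v x < ρ i := by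
    intro i v hv
    rw [mem_ball] at hv
    have := dist_triangle v (x + (3 / 4 * ρ i) • e) x
    rw [hcen] at this
    linarith
  have hlo : ∀ i, ∀ v ∈ ball (x + (3 / 4 * ρ i) • e) (ρ i / 4), ρ i / 2 < dist v x := by
    intro i v hv
    rw [mem_ball] at hv
    have := dist_triangle (x + (3 / 4 * ρ i) • e) v x
    rw [hcen, dist_comm _ v] at this
    linarith
  have hρle : ∀ i, ρ i ≤ D x / 20 := fun i => by rw [← hρ0]; exact hρanti (Nat.zero_le i)
  have hsub : ∀ i, ∀ v ∈ ball (x + (3 / 4 * ρ i) • e) (ρ i / 4), v ∈ Ω := fun i v hv =>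
    H.ball_sub (x := x) (by linarith [hup i v hv, hρle i])
  have hnn : ∀ i, 0 ≤ (ρ i / 4) ^ s * g (w i) := fun i => by
    have := hρpos i
    have := H.hg0 (w i)
    positivity
  have hsum := sum_bound H.hF H.hpq (m + 1) (fun i => ball (x + (3 / 4 * ρ i) • e) (ρ i / 4))
    (fun i => (ρ i / 4) ^ s * g (w i)) (fun _ _ => measurableSet_ball)
    (fun i _ v hv => hsub i v hv)
    (by
      intro i j hij hj
      rw [Set.disjoint_left]
      intro v hv hv'
      have h1 := hlo i v hv
      have h2 := hup j v hv'
      have h3 := hρanti (show i + 1 ≤ j by omega)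
      rw [hρs] at h3
      linarith)
    (fun i _ => hnn i) (fun i _ => hwg i)
  have htel := telescope (fun i => u (w i)) (fun i => (ρ i / 4) ^ s * g (w i)) 12
    (by norm_num) m (fun i _ => hnn i) (by
      intro i hi
      have h1 := hup i _ (hwb i)
      have h2 := hup (i+1) _ (hwb (i+1))
      rw [hρs] at h2
      have l3 := lip_dist H.hD x (w i)
      rw [dist_comm] at l3
      have t := dist_triangle_right (w i) (w (i+1)) x
      have := hρpos i
      have := hρle i
      exact H.step (hsub i _ (hwb i)) (hwN i) (hsub _ _ (hwb (i+1))) (hwN _) (by linarith)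
        (by norm_num) (by linarith) (by rw [hρs]; linarith) (by linarith)
        (by rw [hρs]; linarith))
  set S := ∑ i ∈ Finset.range (m+1), (ρ i / 4) ^ s * g (w i) with hS
  have ha : ∀ i < m + 1, (ρ i / 4) ^ s * g (w i) ≤ S := fun i hi =>
    Finset.single_le_sum (f := fun i => (ρ i / 4) ^ s * g (w i)) (fun i _ => hnn i)
      (Finset.mem_range.2 hi)
  have ha0 := ha 0 (by omega)
  have ham := ha m (by omega)
  obtain ⟨y1, y2, y3⟩ := hY x hx
  have hY1 := sum_bound H.hF H.hpq 1 (fun _ => ball x (D x / 20))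
    (fun _ => (D x / 20) ^ s * g (Y x)) (fun _ _ => measurableSet_ball)
    (fun i _ v hv => H.ball_sub (x := x) (by rw [mem_ball] at hv; linarith))
    (by intro i j h1 h2; omega) (fun _ _ => by have := H.hg0 (Y x); positivity)
    (fun _ _ => y3)
  simp only [Finset.range_one, Finset.sum_singleton, Nat.cast_one, Real.one_rpow, mul_one] at hY1
  have hk := kap_pos (n := n)
  have hκ : 0 ≤ (2 * kap n) ^ (1 / p) := by positivity
  have hq := H.hpq.symm.pos
  have hL : (1:ℝ) ≤ ((m + 1 : ℕ) : ℝ) ^ (1 / q) := by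
    apply Real.one_le_rpow
    · push_cast; linarith [Nat.cast_nonneg (α := ℝ) m]
    · positivity
  have hκL : (2 * kap n) ^ (1 / p) ≤ (2 * kap n) ^ (1 / p) * ((m + 1 : ℕ) : ℝ) ^ (1 / q) :=
    le_mul_of_one_le_right hκ hL
  rw [mem_ball] at y1
  have s1 : |u (w 0) - u (Y x)| ≤ 8 * ((ρ 0 / 4) ^ s * g (w 0) + (D x / 20) ^ s * g (Y x)) := by
    have h1 := hup 0 _ (hwb 0)
    have l3 := lip_dist H.hD x (w 0)
    rw [dist_comm] at l3
    have t := dist_triangle_right (w 0) (Y x) x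
    have := hρpos 0
    exact H.step (hsub 0 _ (hwb 0)) (hwN 0) (H.ball_sub (x := x) (by linarith)) y2 (by linarith)
      (by norm_num) (by linarith) (by linarith) (by linarith) (by linarith)
  have s2 : |u x - u (w m)| ≤ 4 * ((ρ m) ^ s * g x + (ρ m / 4) ^ s * g (w m)) := by
    have h1 := hup m _ (hwb m)
    rw [dist_comm] at h1
    have := hρpos m
    have := hρle m
    exact H.step hx hxN (hsub m _ (hwb m)) (hwN m) (by linarith)
      (by norm_num) (by linarith) (by linarith) (by linarith) (by linarith)
  have hm' : (ρ m) ^ s * g x ≤ 1 := hm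
  have f1 := abs_le.1 s1
  have f2 := abs_le.1 s2
  have f3 := abs_le.1 htel
  rw [abs_le]
  constructor <;> linarith

lemma pointwise_est (hn : 2 ≤ n) {Ω : Set (Eu n)} {D : Eu n → ℝ} {N : Set (Eu n)} {s p q : ℝ}
    {u g : Eu n → ℝ} (H : HajSetup n Ω D N s p q u g) {Y : Eu n → Eu n}
    (hY : GoodSel n Ω D N s p g Y) {x y : Eu n} (hx : x ∈ Ω) (hxN : x ∉ N) {m M₀ : ℕ}
    (hm : (D x / 20 * (1 / 2) ^ m) ^ s * g x ≤ 1)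
    (h : ∃ z : ℕ → Eu n, z 0 = x ∧ z M₀ = y ∧ (∀ i ≤ M₀, z i ∈ Ω) ∧
      ∀ i < M₀, dist (z i) (z (i + 1)) < 1 / 20 * (D (z i) + D (z (i + 1)))) :
    |u x - u (Y y)| ^ q ≤ (4 + 54 * (2 * kap n) ^ (1 / p)) ^ q * (M₀ + m + 2) := by
  obtain ⟨M, hM, z, z0, zM, hz, hadj, hsep⟩ := min_chain h
  have h1 := chain_part H hY z0 zM hz hadj hsep
  have h2 := inner_part hn H hY hx hxN hm
  have hk := kap_pos (n := n)
  have hκ : 0 ≤ (2 * kap n) ^ (1 / p) := by positivity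
  have hq := H.hpq.symm.pos
  have hM' : (M : ℝ) ≤ M₀ := by exact_mod_cast hM
  have hm0 := Nat.cast_nonneg (α := ℝ) m
  have hM0 := Nat.cast_nonneg (α := ℝ) M
  have e1 : ((m + 1 : ℕ) : ℝ) ^ (1 / q) ≤ ((M₀ : ℝ) + m + 2) ^ (1 / q) := by
    apply Real.rpow_le_rpow (by positivity) _ (by positivity)
    push_cast; linarith
  have e2 : ((M + 1 : ℕ) : ℝ) ^ (1 / q) ≤ ((M₀ : ℝ) + m + 2) ^ (1 / q) := by
    apply Real.rpow_le_rpow (by positivity) _ (by positivity)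
    push_cast; linarith
  have e3 : (1:ℝ) ≤ ((M₀ : ℝ) + m + 2) ^ (1 / q) :=
    Real.one_le_rpow (by linarith) (by positivity)
  have e4 := mul_le_mul_of_nonneg_left e1 hκ
  have e5 := mul_le_mul_of_nonneg_left e2 hκ
  have e6 : |u x - u (Y y)| ≤
      (4 + 54 * (2 * kap n) ^ (1 / p)) * ((M₀ : ℝ) + m + 2) ^ (1 / q) := by
    have := abs_sub_le (u x) (u (Y x)) (u (Y y))
    linarith
  calc |u x - u (Y y)| ^ q
      ≤ ((4 + 54 * (2 * kap n) ^ (1 / p)) * ((M₀ : ℝ) + m + 2) ^ (1 / q)) ^ q :=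
        Real.rpow_le_rpow (abs_nonneg _) e6 hq.le
    _ = _ := by
      rw [Real.mul_rpow (by positivity) (by positivity), ← Real.rpow_mul (by positivity),
        one_div_mul_cancel hq.ne', Real.rpow_one]

end part6

section part7
variable {n : ℕ}

lemma chain_len {D : Eu n → ℝ} {Ω : Set (Eu n)} (hD : LipschitzWith 1 D)
    (hDΩ : ∀ x, 0 < D x ↔ x ∈ Ω) {x x₀ : Eu n} {I' : ℝ}
    (h : ∃ ℓ : ℝ, 0 ≤ ℓ ∧ ∃ γ : ℝ → Eu n, LipschitzOnWith 1 γ (Icc 0 ℓ) ∧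
      γ 0 = x ∧ γ ℓ = x₀ ∧ (∀ t ∈ Icc (0:ℝ) ℓ, γ t ∈ Ω) ∧
      ∫ t in (0:ℝ)..ℓ, (D (γ t))⁻¹ ≤ I') :
    ∃ M₀ : ℕ, (M₀ : ℝ) ≤ 21 * I' + 2 ∧
    ∃ z : ℕ → Eu n, z 0 = x ∧ z M₀ = x₀ ∧ (∀ i ≤ M₀, z i ∈ Ω) ∧
      ∀ i < M₀, dist (z i) (z (i + 1)) < 1 / 20 * (D (z i) + D (z (i + 1))) := by
  obtain ⟨ℓ, hℓ, γ, hγ, h0, h1, hΩ, hI⟩ := h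
  have hpos : ∀ t ∈ Icc (0:ℝ) ℓ, 0 < D (γ t) := fun t ht => (hDΩ _).2 (hΩ t ht)
  have hI0 : 0 ≤ ∫ t in (0:ℝ)..ℓ, (D (γ t))⁻¹ :=
    intervalIntegral.integral_nonneg hℓ (fun t ht => (inv_pos.2 (hpos t ht)).le)
  have hI'0 : 0 ≤ 21 * I' := by linarith
  obtain ⟨M, hM, z, z0, zM, hz, hzd⟩ := chain_of_curve hD hγ hpos (ε := 1 / 20) (by norm_num)
    ⌈21 * I'⌉₊ 0 ⟨le_rfl, hℓ⟩ (by
      have := Nat.le_ceil (21 * I')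
      have e : (1:ℝ) / 20 / (1 + 1 / 20) = 1 / 21 := by norm_num
      rw [e]; linarith)
  have hzΩ : ∀ i ≤ M, z i ∈ Ω := by
    intro i hi
    obtain ⟨t, ht, he⟩ := hz i hi
    rw [← he]; exact hΩ t ht
  refine ⟨M, ?_, z, z0.trans h0, zM.trans h1, hzΩ, ?_⟩
  · have h3 := Nat.ceil_lt_add_one hI'0
    have : (M : ℝ) ≤ (⌈21 * I'⌉₊ : ℝ) + 1 := by exact_mod_cast hM
    linarith
  · intro i hi
    have := hzd i hi
    have := (hDΩ _).2 (hzΩ (i+1) (by omega))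
    linarith

lemma exists_m {s d G : ℝ} (hs0 : 0 < s) (hd : 0 < d) (hG : 0 ≤ G) :
    ∃ m : ℕ, (d / 20 * (1 / 2) ^ m) ^ s * G ≤ 1 ∧ (2:ℝ) ^ m ≤ 2 * (1 + d * G ^ (1 / s)) := by
  have ht : 1 ≤ 1 + d * G ^ (1 / s) := by
    have : 0 ≤ d * G ^ (1 / s) := by positivity
    linarith
  obtain ⟨k, h1, h2⟩ := exists_nat_pow_near ht (one_lt_two)
  refine ⟨k + 1, ?_, by rw [pow_succ]; linarith⟩
  have e : G = (G ^ (1 / s)) ^ s := by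
    rw [← Real.rpow_mul hG, one_div_mul_cancel hs0.ne', Real.rpow_one]
  have hG' : 0 ≤ G ^ (1 / s) := by positivity
  have : (d / 20 * (1 / 2) ^ (k+1)) ^ s * G = (d / 20 * (1 / 2) ^ (k+1) * G ^ (1 / s)) ^ s := by
    rw [Real.mul_rpow (by positivity) hG', ← e]
  rw [this]
  apply Real.rpow_le_one (by positivity) _ hs0.le
  rw [one_div, inv_pow]
  have h3 : (0:ℝ) < 2 ^ (k+1) := by positivity
  have : d / 20 * (2 ^ (k+1))⁻¹ * G ^ (1/s) = (d * G ^ (1/s) / 20) / 2 ^ (k+1) := by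
    rw [div_eq_mul_inv _ ((2:ℝ)^(k+1))]; ring
  rw [this, div_le_one h3]
  have : 0 ≤ d * G ^ (1 / s) := by positivity
  linarith

lemma rpow_le_one_add {t a b : ℝ} (ht : 0 ≤ t) (ha : 0 ≤ a) (hab : a ≤ b) :
    t ^ a ≤ 1 + t ^ b := by
  rcases le_total t 1 with h | h
  · have := Real.rpow_le_one ht h ha
    have := Real.rpow_nonneg ht b
    linarith
  · have := Real.rpow_le_rpow_of_exponent_le h hab
    linarith

/-- Pointwise exponential bound. -/
lemma exp_pt {τ C β d K G s p : ℝ} {M m : ℕ} (hτ : 0 < τ) (hτ2 : 2 * τ ≤ Real.log 2)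
    (hC : 1 ≤ C) (hτβ : 42 * C * τ ≤ β) (hd : 0 < d) (hdK : d ≤ K) (hG : 0 ≤ G) (hs : 0 < s)
    (hsp : 1 / s ≤ p)
    (hM : (M : ℝ) ≤ 21 * (C * Real.log (C / d) + 1) + 2)
    (hm : (2:ℝ) ^ m ≤ 2 * (1 + d * G ^ (1 / s))) :
    Real.exp (τ * (M + m + 2)) ≤
      Real.exp (2 * τ) * (Real.exp (46 * τ) * C ^ (42 * C * τ) + 2 + 2 * K) +
      Real.exp (2 * τ) * (Real.exp (46 * τ) * C ^ (42 * C * τ)) * d ^ (-β) +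
      Real.exp (2 * τ) * (2 * K) * G ^ p := by
  have hC0 : 0 < C := by linarith
  have hK : 0 < K := by linarith
  have e1 : Real.exp (2 * τ * M) ≤ Real.exp (46 * τ) * C ^ (42 * C * τ) * (1 + d ^ (-β)) := by
    have h1 : Real.exp (2 * τ * M) ≤ Real.exp (46 * τ + Real.log (C / d) * (42 * C * τ)) := by
      apply Real.exp_le_exp.2
      have := mul_le_mul_of_nonneg_left hM (by positivity : 0 ≤ 2 * τ)
      linarith
    have h2 : Real.exp (46 * τ + Real.log (C / d) * (42 * C * τ)) =
        Real.exp (46 * τ) * C ^ (42 * C * τ) * (d⁻¹) ^ (42 * C * τ) := by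
      rw [Real.exp_add, ← Real.rpow_def_of_pos (by positivity), div_eq_mul_inv,
        Real.mul_rpow hC0.le (by positivity)]
      ring
    have h3 : (d⁻¹) ^ (42 * C * τ) ≤ 1 + d ^ (-β) := by
      have := rpow_le_one_add (t := d⁻¹) (by positivity) (by positivity) hτβ
      rwa [Real.inv_rpow hd.le β, ← Real.rpow_neg hd.le] at this
    rw [h2] at h1
    exact h1.trans (mul_le_mul_of_nonneg_left h3 (by positivity))
  have e2 : Real.exp (2 * τ * m) ≤ 2 + 2 * K + 2 * K * G ^ p := by
    have h1 : Real.exp (2 * τ * m) ≤ 2 ^ m := by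
      rw [← Real.exp_log (show (0:ℝ) < 2 by norm_num), ← Real.exp_nat_mul, Real.exp_log two_pos]
      apply Real.exp_le_exp.2
      rw [mul_comm]
      exact mul_le_mul_of_nonneg_left hτ2 (Nat.cast_nonneg m)
    have h2 := rpow_le_one_add hG (by positivity) hsp
    have h3 : d * G ^ (1 / s) ≤ K * (1 + G ^ p) := by
      have : 0 ≤ G ^ (1 / s) := by positivity
      gcongr
    linarith
  have e3 : Real.exp (τ * (M + m + 2)) = Real.exp (2 * τ) * (Real.exp (τ * M) * Real.exp (τ * m)) := by
    rw [← Real.exp_add, ← Real.exp_add]; congr 1; ring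
  have e4 : Real.exp (τ * M) * Real.exp (τ * m) ≤ Real.exp (2 * τ * M) + Real.exp (2 * τ * m) := by
    have a1 : Real.exp (2 * τ * M) = Real.exp (τ * M) ^ 2 := by
      rw [← Real.exp_nat_mul]; congr 1; push_cast; ring
    have a2 : Real.exp (2 * τ * m) = Real.exp (τ * m) ^ 2 := by
      rw [← Real.exp_nat_mul]; congr 1; push_cast; ring
    rw [a1, a2]
    nlinarith [sq_nonneg (Real.exp (τ * M) - Real.exp (τ * m)), sq_nonneg (Real.exp (τ * M)),
      sq_nonneg (Real.exp (τ * m))]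
  rw [e3]
  have := mul_le_mul_of_nonneg_left (e4.trans (add_le_add e1 e2)) (Real.exp_pos (2 * τ)).le
  linarith

lemma core (hn : 2 ≤ n) {Ω : Set (Eu n)} (hfin : volume Ω < ⊤) (hΩm : MeasurableSet Ω)
    {D : Eu n → ℝ} (hD : LipschitzWith 1 D) (hDΩ : ∀ x, 0 < D x ↔ x ∈ Ω) {K : ℝ}
    (hK : ∀ x ∈ Ω, D x ≤ K) {x₀ : Eu n} (hx₀ : x₀ ∈ Ω)
    {C : ℝ} (hC : 1 ≤ C)
    (hcur : ∀ x ∈ Ω, ∃ ℓ : ℝ, 0 ≤ ℓ ∧ ∃ γ : ℝ → Eu n, LipschitzOnWith 1 γ (Icc 0 ℓ) ∧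
      γ 0 = x ∧ γ ℓ = x₀ ∧ (∀ t ∈ Icc (0:ℝ) ℓ, γ t ∈ Ω) ∧
      ∫ t in (0:ℝ)..ℓ, (D (γ t))⁻¹ ≤ C * Real.log (C / D x) + 1) {s p q : ℝ}
    (hs : 0 < s) (hsp : s * p = n) :
    ∃ τ : ℝ, 0 < τ ∧ ∃ B : ℝ≥0∞, B < ⊤ ∧ ∀ (N : Set (Eu n)) (u g : Eu n → ℝ),
      HajSetup n Ω D N s p q u g →
      ∃ c : ℝ, ∫⁻ x in Ω, ENNReal.ofReal (Real.exp (τ * |u x - c| ^ q)) ≤ B := by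
  obtain ⟨β, hβ, hIntg⟩ := dist_integrable hfin hΩm hD hDΩ hx₀ hC hcur
  have hC0 : 0 < C := by linarith
  have hk := kap_pos (n := n)
  have hK0 : 0 < K := lt_of_lt_of_le ((hDΩ _).2 hx₀) (hK _ hx₀)
  set A : ℝ := (4 + 54 * (2 * kap n) ^ (1 / p)) ^ q with hA
  have hA0 : 0 < A := by positivity
  set τ : ℝ := min (β / (42 * C)) (Real.log 2 / 2) with hτdef
  have hlog := Real.log_pos one_lt_two
  have hτ : 0 < τ := by rw [hτdef]; positivity
  have hτ2 : 2 * τ ≤ Real.log 2 := by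
    have := min_le_right (β / (42 * C)) (Real.log 2 / 2)
    linarith
  have hτβ : 42 * C * τ ≤ β := by
    have := min_le_left (β / (42 * C)) (Real.log 2 / 2)
    rw [← hτdef, le_div_iff₀ (by positivity)] at this
    linarith
  set K1 := Real.exp (2 * τ) * (Real.exp (46 * τ) * C ^ (42 * C * τ) + 2 + 2 * K) with hK1
  set K2 := Real.exp (2 * τ) * (Real.exp (46 * τ) * C ^ (42 * C * τ)) with hK2
  set K3 := Real.exp (2 * τ) * (2 * K) with hK3
  have hK10 : 0 ≤ K1 := by positivity
  have hK20 : 0 ≤ K2 := by positivity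
  have hK30 : 0 ≤ K3 := by positivity
  refine ⟨τ / A, by positivity, ENNReal.ofReal K1 * volume Ω +
    ENNReal.ofReal K2 * (∫⁻ x in Ω, ENNReal.ofReal (D x ^ (-β))) + ENNReal.ofReal K3 * 1, ?_, ?_⟩
  · refine ENNReal.add_lt_top.2 ⟨ENNReal.add_lt_top.2 ⟨?_, ?_⟩, ?_⟩
    · exact ENNReal.mul_lt_top ENNReal.ofReal_lt_top hfin
    · exact ENNReal.mul_lt_top ENNReal.ofReal_lt_top hIntg
    · exact ENNReal.mul_lt_top ENNReal.ofReal_lt_top ENNReal.one_lt_top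
  intro N u g H
  obtain ⟨Y, hY⟩ := exists_goodSel H
  refine ⟨u (Y x₀), ?_⟩
  have hpt : ∀ x ∈ Ω, x ∉ N → ENNReal.ofReal (Real.exp (τ / A * |u x - u (Y x₀)| ^ q)) ≤
      ENNReal.ofReal K1 + ENNReal.ofReal K2 * ENNReal.ofReal (D x ^ (-β)) +
        ENNReal.ofReal K3 * ENNReal.ofReal (g x ^ p) := by
    intro x hx hxN
    have hDx := (hDΩ _).2 hx
    obtain ⟨M₀, hM₀, hch⟩ := chain_len hD hDΩ (hcur x hx)
    obtain ⟨m, hm1, hm2⟩ := exists_m hs hDx (H.hg0 x)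
    have h1 := pointwise_est hn H hY hx hxN hm1 hch
    have hsp1 : 1 / s ≤ p := by
      rw [div_le_iff₀ hs, mul_comm, hsp]
      have : (2:ℝ) ≤ n := by exact_mod_cast hn
      linarith
    have h2 := exp_pt hτ hτ2 hC hτβ hDx (hK x hx) (H.hg0 x) hs hsp1 hM₀ hm2
    have h3 : τ / A * |u x - u (Y x₀)| ^ q ≤ τ * (M₀ + m + 2) := by
      have := mul_le_mul_of_nonneg_left h1 (by positivity : 0 ≤ τ / A)
      refine this.trans (le_of_eq ?_)
      rw [← hA]
      field_simp
    have hDβ : 0 ≤ D x ^ (-β) := by positivity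
    have hgp : 0 ≤ g x ^ p := Real.rpow_nonneg (H.hg0 x) p
    rw [← ENNReal.ofReal_mul hK20, ← ENNReal.ofReal_mul hK30,
      ← ENNReal.ofReal_add hK10 (by positivity), ← ENNReal.ofReal_add (by positivity) (by positivity)]
    exact ENNReal.ofReal_le_ofReal ((Real.exp_le_exp.2 h3).trans h2)
  have hae : ∀ᵐ x ∂(volume.restrict Ω), ENNReal.ofReal (Real.exp (τ / A * |u x - u (Y x₀)| ^ q)) ≤
      ENNReal.ofReal K1 + ENNReal.ofReal K2 * ENNReal.ofReal (D x ^ (-β)) +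
        ENNReal.ofReal K3 * ENNReal.ofReal (g x ^ p) := by
    rw [ae_restrict_iff' hΩm]
    have : ∀ᵐ x ∂(volume : Measure (Eu n)), x ∉ N := measure_eq_zero_iff_ae_notMem.1 H.hN
    filter_upwards [this] with x hxN hx
    exact hpt x hx hxN
  refine (lintegral_mono_ae hae).trans ?_
  have hDm : Measurable D := hD.continuous.measurable
  have hgm := H.hg
  rw [lintegral_add_left (by fun_prop), lintegral_add_left (by fun_prop),
    lintegral_const_mul _ (by fun_prop), lintegral_const_mul _ (by fun_prop), lintegral_const,
    Measure.restrict_apply_univ]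
  gcongr
  exact H.hF

end part7

section part8
variable {n : ℕ}

lemma add_rpow_le' {a b q : ℝ} (ha : 0 ≤ a) (hb : 0 ≤ b) (hq : 0 ≤ q) :
    (a + b) ^ q ≤ 2 ^ q * (a ^ q + b ^ q) := by
  have h1 : (a + b) ^ q ≤ (2 * max a b) ^ q := by
    apply Real.rpow_le_rpow (by positivity) _ hq
    linarith [le_max_left a b, le_max_right a b]
  rw [Real.mul_rpow (by norm_num) (le_max_of_le_left ha)] at h1
  refine h1.trans (mul_le_mul_of_nonneg_left ?_ (by positivity))
  have ha' := Real.rpow_nonneg ha q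
  have hb' := Real.rpow_nonneg hb q
  rcases max_cases a b with h | h <;> rw [h.1] <;> linarith

lemma exp_div_le {a l : ℝ} (hl : 1 ≤ l) : Real.exp (a / l) - 1 ≤ Real.exp a / l := by
  have hl0 : 0 < l := by linarith
  have hh := convexOn_exp.2
  have h := hh (mem_univ a) (mem_univ 0) (show 0 ≤ 1 / l by positivity)
    (show 0 ≤ 1 - 1 / l by rw [sub_nonneg, div_le_one hl0]; exact hl) (by ring)
  simp only [smul_eq_mul, mul_zero, add_zero, Real.exp_zero, mul_one] at h
  have e : 1 / l * a = a / l := by ring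
  have e' : 1 / l * Real.exp a = Real.exp a / l := by ring
  rw [e, e'] at h
  have : 0 ≤ 1 / l := by positivity
  linarith

lemma trud {Ω : Set (Eu n)} (hfin : volume Ω < ⊤) (hV : volume Ω ≠ 0) {τ q : ℝ} (hτ : 0 < τ)
    (hq : 1 ≤ q) {B : ℝ≥0∞} (hB : B < ⊤) :
    ∃ C : ℝ, 0 < C ∧ ∀ u : Eu n → ℝ, Measurable u → ∀ c : ℝ,
      ∫⁻ x in Ω, ENNReal.ofReal (Real.exp (τ * |u x - c| ^ q)) ≤ B →
      ∫⁻ x in Ω, ENNReal.ofReal (Real.exp ((|u x - ⨍ y in Ω, u y| / C) ^ q) - 1) ≤ 1 := by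
  set V := (volume Ω).toReal with hVdef
  set b := B.toReal with hb
  have hV0 : 0 < V := ENNReal.toReal_pos hV hfin.ne
  have hb0 : 0 ≤ b := ENNReal.toReal_nonneg
  set A : ℝ := V⁻¹ * (V + 1 / τ * b) with hA
  have hA0 : 0 ≤ A := by positivity
  set σ : ℝ := τ / 2 ^ q with hσ
  have hσ0 : 0 < σ := by positivity
  set l : ℝ := max (Real.exp (τ * A ^ q) * b) 1 with hl
  have hl1 : 1 ≤ l := le_max_right _ _
  have hl0 : 0 < l := by linarith
  have hq0 : 0 < q := by linarith
  refine ⟨(l / σ) ^ (1 / q), by positivity, ?_⟩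
  intro u hu c hIntg
  have hCq : ((l / σ) ^ (1 / q)) ^ q = l / σ := by
    rw [← Real.rpow_mul (by positivity), one_div_mul_cancel hq0.ne', Real.rpow_one]
  have hfm : IsFiniteMeasure (volume.restrict Ω) :=
    ⟨by rw [Measure.restrict_apply_univ]; exact hfin⟩
  -- first moment
  have hmom : ∫⁻ x in Ω, ENNReal.ofReal ‖u x - c‖ ≤ ENNReal.ofReal (V + 1 / τ * b) := by
    have hpt : ∀ x, ENNReal.ofReal ‖u x - c‖ ≤ 1 + ENNReal.ofReal (1 / τ) *
        ENNReal.ofReal (Real.exp (τ * |u x - c| ^ q)) := by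
      intro x
      rw [← ENNReal.ofReal_one, ← ENNReal.ofReal_mul (by positivity),
        ← ENNReal.ofReal_add zero_le_one (by positivity)]
      apply ENNReal.ofReal_le_ofReal
      rw [Real.norm_eq_abs]
      have h1 := rpow_le_one_add (abs_nonneg (u x - c)) zero_le_one hq
      rw [Real.rpow_one] at h1
      have h2 := Real.add_one_le_exp (τ * |u x - c| ^ q)
      have h3 : |u x - c| ^ q ≤ 1 / τ * Real.exp (τ * |u x - c| ^ q) := by
        rw [one_div, inv_mul_eq_div, le_div_iff₀ hτ]
        linarith
      linarith
    calc ∫⁻ x in Ω, ENNReal.ofReal ‖u x - c‖ ≤ ∫⁻ x in Ω, (1 + ENNReal.ofReal (1 / τ) *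
        ENNReal.ofReal (Real.exp (τ * |u x - c| ^ q))) := lintegral_mono hpt
      _ = volume Ω + ENNReal.ofReal (1 / τ) *
        ∫⁻ x in Ω, ENNReal.ofReal (Real.exp (τ * |u x - c| ^ q)) := by
          rw [lintegral_add_left (by fun_prop), lintegral_const_mul _ (by fun_prop)]
          simp
      _ ≤ volume Ω + ENNReal.ofReal (1 / τ) * B := by gcongr
      _ = ENNReal.ofReal (V + 1 / τ * b) := by
          rw [ENNReal.ofReal_add (by positivity) (by positivity),
            ENNReal.ofReal_mul (by positivity), hVdef, hb, ENNReal.ofReal_toReal hfin.ne,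
            ENNReal.ofReal_toReal hB.ne]
  have hintc : Integrable (fun x => u x - c) (volume.restrict Ω) := by
    refine ⟨by fun_prop, ?_⟩
    rw [hasFiniteIntegral_iff_norm]
    exact hmom.trans_lt ENNReal.ofReal_lt_top
  have hintu : Integrable u (volume.restrict Ω) := by
    have := hintc.add (integrable_const c)
    refine this.congr (Filter.Eventually.of_forall (fun x => ?_))
    simp
  have havg : |(⨍ y in Ω, u y) - c| ≤ A := by
    have e : (⨍ y in Ω, u y) - c = V⁻¹ * ∫ y in Ω, (u y - c) := by
      rw [setAverage_eq, integral_sub hintu (integrable_const c), integral_const, smul_eq_mul,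
        smul_eq_mul]
      have : (volume.restrict Ω).real univ = V := by
        rw [Measure.real, Measure.restrict_apply_univ]
      rw [this, Measure.real, ← hVdef]
      field_simp
    rw [e, abs_mul, abs_of_pos (inv_pos.2 hV0), hA]
    gcongr
    have h1 := norm_integral_le_lintegral_norm (μ := volume.restrict Ω) (fun y => u y - c)
    rw [Real.norm_eq_abs] at h1
    refine h1.trans ?_
    exact ENNReal.toReal_le_of_le_ofReal (by positivity) hmom
  set a := ⨍ y in Ω, u y with ha
  have hpt : ∀ x, ENNReal.ofReal (Real.exp ((|u x - a| / (l / σ) ^ (1 / q)) ^ q) - 1) ≤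
      ENNReal.ofReal (Real.exp (τ * A ^ q) / l) *
        ENNReal.ofReal (Real.exp (τ * |u x - c| ^ q)) := by
    intro x
    rw [← ENNReal.ofReal_mul (by positivity)]
    apply ENNReal.ofReal_le_ofReal
    rw [Real.div_rpow (abs_nonneg _) (by positivity), hCq]
    have e : |u x - a| ^ q / (l / σ) = (σ * |u x - a| ^ q) / l := by
      field_simp
    rw [e]
    refine (exp_div_le hl1).trans ?_
    have h1 : |u x - a| ≤ |u x - c| + A := by
      have := abs_sub_le (u x) c a
      rw [abs_sub_comm c a] at this
      linarith
    have h2 : |u x - a| ^ q ≤ 2 ^ q * (|u x - c| ^ q + A ^ q) :=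
      (Real.rpow_le_rpow (abs_nonneg _) h1 hq0.le).trans
        (add_rpow_le' (abs_nonneg _) hA0 hq0.le)
    have h3 : σ * |u x - a| ^ q ≤ τ * A ^ q + τ * |u x - c| ^ q := by
      have := mul_le_mul_of_nonneg_left h2 hσ0.le
      refine this.trans (le_of_eq ?_)
      rw [hσ]
      have : (2:ℝ) ^ q ≠ 0 := by positivity
      field_simp
      ring
    calc Real.exp (σ * |u x - a| ^ q) / l
        ≤ Real.exp (τ * A ^ q + τ * |u x - c| ^ q) / l := by gcongr
      _ = _ := by rw [Real.exp_add]; ring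
  calc _ ≤ ∫⁻ x in Ω, ENNReal.ofReal (Real.exp (τ * A ^ q) / l) *
        ENNReal.ofReal (Real.exp (τ * |u x - c| ^ q)) := lintegral_mono hpt
    _ = ENNReal.ofReal (Real.exp (τ * A ^ q) / l) *
        ∫⁻ x in Ω, ENNReal.ofReal (Real.exp (τ * |u x - c| ^ q)) := by
        rw [lintegral_const_mul _ (by fun_prop)]
    _ ≤ ENNReal.ofReal (Real.exp (τ * A ^ q) / l) * B := by gcongr
    _ = ENNReal.ofReal (Real.exp (τ * A ^ q) / l * b) := by
        rw [ENNReal.ofReal_mul (by positivity), hb, ENNReal.ofReal_toReal hB.ne]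
    _ ≤ 1 := by
        rw [← ENNReal.ofReal_one]
        apply ENNReal.ofReal_le_ofReal
        rw [div_mul_eq_mul_div, div_le_one hl0]
        exact le_max_left _ _

end part8

section part9
variable {n : ℕ}

lemma hajSetup_of_DBall (hn : 2 ≤ n) {Ω : Set (Eu n)} (ho : IsOpen Ω) (hne : Ωᶜ.Nonempty) {s : ℝ}
    (hs0 : 0 < s) (hs1 : s ≤ 1) {u g : Eu n → ℝ} (hg : g ∈ DBall Ω s (1/2) u) {M : ℝ} (hM : 0 < M)
    (hgM : eLpNorm g (ENNReal.ofReal ((n:ℝ) / s)) (volume.restrict Ω) ≤ ENNReal.ofReal M) :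
    ∃ N, HajSetup n Ω (fun x => infDist x Ωᶜ) N s ((n:ℝ) / s) ((n:ℝ) / ((n:ℝ) - s))
      (fun x => u x / M) (fun x => g x / M) := by
  obtain ⟨hgm, hg0, N, hNΩ, hN, hh⟩ := hg
  have hn2 : (2:ℝ) ≤ n := by exact_mod_cast hn
  have hp : 0 < (n:ℝ) / s := by positivity
  refine ⟨N, lipschitz_infDist_pt _, ?_, hs0, hs1, ?_, ?_, by fun_prop, ?_, hN, ?_, ?_⟩
  · intro x
    rw [← ho.isClosed_compl.notMem_iff_infDist_pos hne, mem_compl_iff, not_not]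
  · field_simp
  · rw [Real.holderConjugate_iff]
    constructor
    · rw [lt_div_iff₀ hs0]; linarith
    · rw [inv_div, inv_div]
      field_simp
      ring
  · intro x
    exact div_nonneg (hg0 x) hM.le
  · rw [eLpNorm_eq_lintegral_rpow_enorm_toReal (by simpa using hp) ENNReal.ofReal_ne_top,
      ENNReal.toReal_ofReal hp.le] at hgM
    have h1 := ENNReal.rpow_le_rpow hgM hp.le
    rw [← ENNReal.rpow_mul, one_div_mul_cancel hp.ne', ENNReal.rpow_one,
      ENNReal.ofReal_rpow_of_pos hM] at h1
    have hMp : 0 < M ^ ((n:ℝ) / s) := by positivity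
    have e : ∀ x, ENNReal.ofReal ((g x / M) ^ ((n:ℝ) / s)) =
        ENNReal.ofReal ((M ^ ((n:ℝ) / s))⁻¹) * ‖g x‖ₑ ^ ((n:ℝ) / s) := by
      intro x
      rw [Real.enorm_eq_ofReal_abs, abs_of_nonneg (hg0 x),
        ENNReal.ofReal_rpow_of_nonneg (hg0 x) hp.le, ← ENNReal.ofReal_mul (by positivity),
        Real.div_rpow (hg0 x) hM.le, div_eq_inv_mul]
    simp_rw [e]
    rw [lintegral_const_mul _ (by fun_prop)]
    calc _ ≤ ENNReal.ofReal ((M ^ ((n:ℝ) / s))⁻¹) * ENNReal.ofReal (M ^ ((n:ℝ) / s)) := by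
          gcongr
      _ = 1 := by
          rw [← ENNReal.ofReal_mul (by positivity), inv_mul_cancel₀ hMp.ne', ENNReal.ofReal_one]
  · intro x hx hxN y hy hyN hd
    have h1 := hh x ⟨hx, hxN⟩ y ⟨hy, hyN⟩ (by
      have : EMetric.infEdist x Ωᶜ = ENNReal.ofReal (infDist x Ωᶜ) := by
        rw [infDist, ENNReal.ofReal_toReal (infEDist_ne_top hne)]; rfl
      rw [this, ← ENNReal.ofReal_mul (by norm_num), edist_dist]
      rw [ENNReal.ofReal_lt_ofReal_iff_of_nonneg dist_nonneg]
      linarith)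
    rw [← sub_div, abs_div, abs_of_pos hM, ← add_div, ← mul_div_assoc]
    gcongr

end part9

/-- Every bounded weak carrot domain supports an `s`-Hajłasz–Trudinger
imbedding for every `s ∈ (0,1]`. -/
theorem stmt5 {n : ℕ} (hn : 2 ≤ n) (Ω : Set (Eu n)) (hΩ : IsDomainEu Ω)
    (hbd : Bornology.IsBounded Ω) (hwc : IsWeakCarrot Ω) :
    ∀ s ∈ Set.Ioc (0:ℝ) 1, SupportsHT Ω s := by
  intro s hs
  obtain ⟨hs0, hs1⟩ := hs
  obtain ⟨ho, hconn⟩ := hΩ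
  obtain ⟨x₀, hx₀, C₀, hC₀, hcarrot⟩ := hwc
  have hn2 : (2:ℝ) ≤ n := by exact_mod_cast hn
  have hFin : Nonempty (Fin n) := ⟨⟨0, by omega⟩⟩
  have hne : Ωᶜ.Nonempty := by
    rw [nonempty_compl]
    rintro rfl
    exact NormedSpace.unbounded_univ ℝ (Eu n) hbd
  have hfin : volume Ω < ⊤ := hbd.measure_lt_top
  have hV : volume Ω ≠ 0 := (ho.measure_pos volume ⟨x₀, hx₀⟩).ne'
  have hDΩ : ∀ x, 0 < infDist x Ωᶜ ↔ x ∈ Ω := fun x => by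
    rw [← ho.isClosed_compl.notMem_iff_infDist_pos hne, mem_compl_iff, not_not]
  obtain ⟨y₀, hy₀⟩ := hne
  obtain ⟨K, hK⟩ := hbd.subset_closedBall y₀
  have hDK : ∀ x ∈ Ω, infDist x Ωᶜ ≤ K := fun x hx =>
    (infDist_le_dist_of_mem hy₀).trans (mem_closedBall.1 (hK hx))
  have hcur : ∀ x ∈ Ω, ∃ ℓ : ℝ, 0 ≤ ℓ ∧ ∃ γ : ℝ → Eu n, LipschitzOnWith 1 γ (Icc 0 ℓ) ∧
      γ 0 = x ∧ γ ℓ = x₀ ∧ (∀ t ∈ Icc (0:ℝ) ℓ, γ t ∈ Ω) ∧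
      ∫ t in (0:ℝ)..ℓ, (infDist (γ t) Ωᶜ)⁻¹ ≤ C₀ * Real.log (C₀ / infDist x Ωᶜ) + 1 := by
    intro x hx
    have h1 : qhDist Ω x x₀ < C₀ * Real.log (C₀ / infDist x Ωᶜ) + 1 := by
      linarith [hcarrot x hx]
    have hnon : { k : ℝ | ∃ ℓ : ℝ, 0 ≤ ℓ ∧ ∃ γ : ℝ → Eu n,
        LipschitzOnWith 1 γ (Set.Icc 0 ℓ) ∧ γ 0 = x ∧ γ ℓ = x₀ ∧
        (∀ t ∈ Set.Icc (0:ℝ) ℓ, γ t ∈ Ω) ∧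
        k = ∫ t in (0:ℝ)..ℓ, (infDist (γ t) Ωᶜ)⁻¹ }.Nonempty := by
      obtain ⟨ℓ, hℓ, γ, a1, a2, a3, a4⟩ := lipJoined_of_domain ho hconn.isPreconnected hx hx₀
      exact ⟨_, ℓ, hℓ, γ, a1, a2, a3, a4, rfl⟩
    obtain ⟨k, ⟨ℓ, hℓ, γ, a1, a2, a3, a4, a5⟩, hk⟩ := exists_lt_of_csInf_lt hnon h1
    exact ⟨ℓ, hℓ, γ, a1, a2, a3, a4, by rw [← a5]; exact hk.le⟩
  have hns : 0 < (n:ℝ) - s := by linarith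
  obtain ⟨τ, hτ, B, hB, hcore⟩ := core hn hfin ho.measurableSet (lipschitz_infDist_pt Ωᶜ) hDΩ hDK hx₀
    hC₀ hcur (s := s) (p := (n:ℝ) / s) (q := (n:ℝ) / ((n:ℝ) - s)) hs0 (by field_simp)
  obtain ⟨C, hC, htr⟩ := trud hfin hV hτ (q := (n:ℝ) / ((n:ℝ) - s))
    (by rw [le_div_iff₀ hns]; linarith) hB
  refine ⟨C, hC, ?_⟩
  intro u hu
  have hum := hu.1
  have key : ∀ g ∈ DBall Ω s (1/2) u, ∀ M : ℝ, 0 < M →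
      eLpNorm g (ENNReal.ofReal ((n:ℝ) / s)) (volume.restrict Ω) ≤ ENNReal.ofReal M →
      phiLux Ω s (fun x => u x - ⨍ y in Ω, u y) ≤ ENNReal.ofReal (C * M) := by
    intro g hg M hM hgM
    obtain ⟨N, H⟩ := hajSetup_of_DBall hn ho ⟨y₀, hy₀⟩ hs0 hs1 hg hM hgM
    obtain ⟨c, hc⟩ := hcore _ _ _ H
    have h2 := htr (fun x => u x / M) (by fun_prop) c hc
    apply sInf_le
    refine ⟨C * M, ⟨by positivity, ?_⟩, rfl⟩
    refine le_trans (le_of_eq ?_) h2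
    congr 1
    ext x
    have e1 : (⨍ y in Ω, u y / M) = (⨍ y in Ω, u y) / M := by
      rw [setAverage_eq, setAverage_eq, integral_div, smul_eq_mul, smul_eq_mul, mul_div_assoc]
    rw [e1, ← sub_div, abs_div, abs_of_pos hM, div_div, mul_comm M C]
  have key2 : ∀ g ∈ DBall Ω s (1/2) u, phiLux Ω s (fun x => u x - ⨍ y in Ω, u y) ≤
      eLpNorm g (ENNReal.ofReal ((n:ℝ) / s)) (volume.restrict Ω) * ENNReal.ofReal C := by
    intro g hg
    have hC' : ENNReal.ofReal C ≠ 0 := by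
      rw [Ne, ENNReal.ofReal_eq_zero]; push Not; exact hC
    by_cases htop : eLpNorm g (ENNReal.ofReal ((n:ℝ) / s)) (volume.restrict Ω) = ⊤
    · rw [htop, ENNReal.top_mul hC']; exact le_top
    set E := (eLpNorm g (ENNReal.ofReal ((n:ℝ) / s)) (volume.restrict Ω)).toReal with hE
    have hE' : eLpNorm g (ENNReal.ofReal ((n:ℝ) / s)) (volume.restrict Ω) = ENNReal.ofReal E :=
      (ENNReal.ofReal_toReal htop).symm
    have hE0 : 0 ≤ E := ENNReal.toReal_nonneg
    apply ENNReal.le_of_forall_pos_le_add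
    intro ε hε _
    have hε' : (0:ℝ) < ε := hε
    have := key g hg (E + ε / C) (by positivity) (by
      rw [hE']; apply ENNReal.ofReal_le_ofReal
      have : 0 < (ε:ℝ) / C := by positivity
      linarith)
    refine this.trans (le_of_eq ?_)
    have e : C * (E + ε / C) = E * C + ε := by field_simp
    rw [e, ENNReal.ofReal_add (by positivity) hε'.le, ENNReal.ofReal_mul hE0, hE',
      ENNReal.ofReal_coe_nnreal]
  have hC' : ENNReal.ofReal C ≠ 0 := by
    rw [Ne, ENNReal.ofReal_eq_zero]; push Not; exact hC
  rw [mul_comm, ← ENNReal.div_le_iff_le_mul (Or.inl hC') (Or.inl ENNReal.ofReal_ne_top)]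
  unfold ballNorm ballNormRho
  refine le_iInf₂ (fun g hg => ?_)
  rw [ENNReal.div_le_iff_le_mul (Or.inl hC') (Or.inl ENNReal.ofReal_ne_top)]
  exact key2 g hg
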